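/- arXiv:1509.02569 — 4 statements merged into one kernel-verified Lean document; each statement's English description precedes it below -/
import Mathlib

section
/- Let K, L ⊂ {0,…,n} be disjoint nonempty sets with |K| = k+1 and |L| = l+1, and let Δ_K, Δ_L, Δ_{K∪L} denote the corresponding faces of a nondegenerate simplex Δ ⊂ ℝⁿ. If f : Δ → ℝ is convex, then Avg(f, Δ_{K∪L}) ≤ ((k+1)/(k+l+2))·Avg(f, Δ_K) + ((l+1)/(k+l+2))·Avg(f, Δ_L). -/
open MeasureTheory

/-- The average value of `f` over a set `S` with respect to `d`-dimensional
Hausdorff measure. -/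
noncomputable def avgH {n : ℕ} (f : EuclideanSpace ℝ (Fin n) → ℝ) (d : ℝ)
    (S : Set (EuclideanSpace ℝ (Fin n))) : ℝ :=
  ⨍ y in S, f y ∂(μH[d])

/-- A convex function that is bounded above on a bounded convex set with nonempty interior is
bounded below there. -/
theorem ConvexOn.bddBelow_image_of_bddAbove {E : Type*} [NormedAddCommGroup E] [NormedSpace ℝ E]
    {s : Set E} {f : E → ℝ} (hf : ConvexOn ℝ s f) (hs : Bornology.IsBounded s)
    (hi : (interior s).Nonempty) (hb : BddAbove (f '' s)) : BddBelow (f '' s) := by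
  obtain ⟨c, hc⟩ := hi
  obtain ⟨r, hr, hball⟩ := Metric.isOpen_iff.1 isOpen_interior c hc
  obtain ⟨D, hD⟩ := hs.subset_closedBall c
  obtain ⟨M, hM⟩ := hb
  have hD0 : 0 ≤ D := dist_nonneg.trans (hD (interior_subset hc))
  obtain ⟨ε, hε, hεr⟩ : ∃ ε : ℝ, 0 < ε ∧ ε * D < r :=
    ⟨r / (D + 1), by positivity, by rw [div_mul_eq_mul_div, div_lt_iff₀ (by positivity)]; nlinarith⟩
  refine ⟨((1 + ε) * f c - M) / ε, ?_⟩
  rintro _ ⟨y, hy, rfl⟩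
  have hyD : ‖c - y‖ ≤ D := by
    have := hD hy
    rwa [Metric.mem_closedBall, dist_comm, dist_eq_norm] at this
  have hz : c + ε • (c - y) ∈ s := by
    refine interior_subset (hball ?_)
    rw [Metric.mem_ball, dist_eq_norm, add_sub_cancel_left, norm_smul, Real.norm_of_nonneg hε.le]
    nlinarith
  have h1 : 0 < 1 + ε := by positivity
  have key := hf.2 hy hz (show 0 ≤ ε / (1 + ε) by positivity)
    (show 0 ≤ 1 / (1 + ε) by positivity) (by field_simp; ring)
  have hcomb : (ε / (1 + ε)) • y + (1 / (1 + ε)) • (c + ε • (c - y)) = c := by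
    match_scalars <;> field_simp; ring
  have hzM := hM ⟨_, hz, rfl⟩
  rw [hcomb, smul_eq_mul, smul_eq_mul, div_mul_eq_mul_div, div_mul_eq_mul_div, ← add_div,
    le_div_iff₀ h1] at key
  rw [div_le_iff₀ hε]
  linarith

/-- A convex function that is bounded above on a compact convex set is integrable there. -/
theorem ConvexOn.integrableOn_of_bddAbove {E : Type*} [NormedAddCommGroup E] [NormedSpace ℝ E]
    [FiniteDimensional ℝ E] [MeasurableSpace E] [BorelSpace E] (μ : Measure E)
    [μ.IsAddHaarMeasure] {s : Set E} {f : E → ℝ} (hf : ConvexOn ℝ s f) (hs : IsCompact s)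
    (hb : BddAbove (f '' s)) : IntegrableOn f s μ := by
  have hae : interior s =ᵐ[μ] s := by
    refine interior_ae_eq_of_null_frontier ?_
    exact hf.1.addHaar_frontier μ
  rcases (interior s).eq_empty_or_nonempty with hi | hi
  · rw [← integrableOn_congr_set_ae hae, hi]
    exact integrableOn_empty
  obtain ⟨M, hM⟩ := hb
  obtain ⟨m, hm⟩ := hf.bddBelow_image_of_bddAbove hs.isBounded hi ⟨M, hM⟩
  rw [← integrableOn_congr_set_ae hae]
  refine IntegrableOn.of_bound (C := max |m| |M|)
    ((measure_mono interior_subset).trans_lt hs.measure_lt_top) ?_ ?_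
  · exact ((hf.subset interior_subset hf.1.interior).continuousOn
      isOpen_interior).aestronglyMeasurable isOpen_interior.measurableSet
  · filter_upwards [ae_restrict_mem isOpen_interior.measurableSet] with y hy
    have hy' := interior_subset hy
    exact abs_le_max_abs_abs (hm ⟨y, hy', rfl⟩) (hM ⟨y, hy', rfl⟩)

/-- Averages with respect to Hausdorff measure of the right dimension can be computed in affine
coordinates, with respect to any Haar measure. -/
theorem setAverage_hausdorffMeasure_image_affineMap {W E : Type*}
    [NormedAddCommGroup W] [NormedSpace ℝ W] [FiniteDimensional ℝ W] [MeasurableSpace W]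
    [BorelSpace W] (μ : Measure W) [μ.IsAddHaarMeasure]
    [NormedAddCommGroup E] [NormedSpace ℝ E] [MeasurableSpace E] [BorelSpace E]
    {φ : W →ᵃ[ℝ] E} (hφ : Function.Injective φ) {d : ℝ} (hd : d = Module.finrank ℝ W)
    (C : Set W) (f : E → ℝ) :
    ⨍ y in φ '' C, f y ∂(μH[d]) = ⨍ w in C, f (φ w) ∂μ := by
  have hlin : Function.Injective φ.linear := φ.linear_injective_iff.2 hφ
  set R := LinearMap.range φ.linear
  let e : W ≃L[ℝ] R := (LinearEquiv.ofInjective φ.linear hlin).toContinuousLinearEquiv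
  have hfin : Module.finrank ℝ R = Module.finrank ℝ W := e.toLinearEquiv.finrank_eq.symm
  have : (μH[d] : Measure R).IsAddHaarMeasure := by
    rw [hd, ← hfin]
    infer_instance
  have : (μ.map e).IsAddHaarMeasure := e.isAddHaarMeasure_map μ
  have hc := Measure.isAddLeftInvariant_eq_smul (μH[d] : Measure R) (μ.map e)
  set c := Measure.addHaarScalarFactor (μH[d] : Measure R) (μ.map e)
  have hc0 : c ≠ 0 := (Measure.addHaarScalarFactor_pos_of_isAddHaarMeasure _ _).ne'
  let ι : R → E := fun r => φ 0 + r
  have hι : Isometry ι := (IsometryEquiv.addLeft (φ 0)).isometry.comp isometry_subtype_coe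
  have hιe : ι ∘ e = φ := by
    funext w
    have := φ.map_vadd 0 w
    simp only [vadd_eq_add, add_zero] at this
    rw [this, add_comm]
    rfl
  have hrange : Set.range ι = Set.range φ := by
    rw [← hιe, e.surjective.range_comp]
  have hmap : (μH[d] : Measure E).restrict (Set.range φ) = c • μ.map φ := by
    rw [← hrange, ← hι.map_hausdorffMeasure (Or.inl (by rw [hd]; positivity)), hc, Measure.map_smul,
      Measure.map_map hι.continuous.measurable e.continuous.measurable, hιe]
  have hemb : MeasurableEmbedding φ := by
    rw [← hιe]
    exact hι.isClosedEmbedding.measurableEmbedding.comp e.toHomeomorph.measurableEmbedding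
  have hres : (μH[d] : Measure E).restrict (φ '' C) = c • (μ.restrict C).map φ := by
    rw [← Measure.restrict_restrict_of_subset (Set.image_subset_range φ C), hmap,
      Measure.restrict_smul, hemb.restrict_map, hφ.preimage_image]
  have hc0' : (c : ℝ) ≠ 0 := NNReal.coe_ne_zero.2 hc0
  rw [average_eq, average_eq, hres, integral_smul_nnreal_measure, hemb.integral_map,
    measureReal_nnreal_smul_apply, measureReal_def, hemb.map_apply, Set.preimage_univ,
    ← measureReal_def, NNReal.smul_def, smul_smul, mul_inv, mul_right_comm, inv_mul_cancel₀ hc0',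
    one_mul]

theorem measurableEmbedding_smul_prod {U V : Type*}
    [NormedAddCommGroup U] [NormedSpace ℝ U] [MeasurableSpace U] [BorelSpace U]
    [NormedAddCommGroup V] [NormedSpace ℝ V] [MeasurableSpace V] [BorelSpace V]
    {a b : ℝ} (ha : a ≠ 0) (hb : b ≠ 0) :
    MeasurableEmbedding fun z : U × V => (a • z.1, b • z.2) :=
  (measurableEmbedding_const_smul₀ ha).prodMap (measurableEmbedding_const_smul₀ hb)

/-- A Haar measure on `U × V` is scaled under `(u, v) ↦ (a • u, b • v)` by the inverse of
`a ^ dim U * b ^ dim V`. -/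
theorem map_smul_prod_addHaar {U V : Type*}
    [NormedAddCommGroup U] [NormedSpace ℝ U] [FiniteDimensional ℝ U] [MeasurableSpace U]
    [BorelSpace U] [NormedAddCommGroup V] [NormedSpace ℝ V] [FiniteDimensional ℝ V]
    [MeasurableSpace V] [BorelSpace V] (μ : Measure (U × V)) [μ.IsAddHaarMeasure]
    {a b : ℝ} (ha : 0 < a) (hb : 0 < b) :
    μ.map (fun z => (a • z.1, b • z.2)) =
      ENNReal.ofReal (a ^ Module.finrank ℝ U * b ^ Module.finrank ℝ V)⁻¹ • μ := by
  let S : U × V →ₗ[ℝ] U × V := (a • LinearMap.id).prodMap (b • LinearMap.id)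
  have hdet : LinearMap.det S = a ^ Module.finrank ℝ U * b ^ Module.finrank ℝ V := by
    rw [LinearMap.det_prodMap, LinearMap.det_smul, LinearMap.det_smul]
    simp
  have hpos : 0 < LinearMap.det S := by rw [hdet]; positivity
  have hmap := Measure.map_linearMap_addHaar_eq_smul_addHaar μ hpos.ne'
  rwa [abs_of_pos (inv_pos.2 hpos), hdet] at hmap

/-- Change of variables `(u, v) ↦ (a • u, b • v)` for the integral over a product of vector spaces. -/
theorem integral_eq_mul_integral_comp_smul_prod {U V : Type*}
    [NormedAddCommGroup U] [NormedSpace ℝ U] [FiniteDimensional ℝ U] [MeasurableSpace U]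
    [BorelSpace U] [NormedAddCommGroup V] [NormedSpace ℝ V] [FiniteDimensional ℝ V]
    [MeasurableSpace V] [BorelSpace V] (μ : Measure (U × V)) [μ.IsAddHaarMeasure]
    {a b : ℝ} (ha : 0 < a) (hb : 0 < b) (g : U × V → ℝ) :
    ∫ z, g z ∂μ = a ^ Module.finrank ℝ U * b ^ Module.finrank ℝ V *
      ∫ z, g (a • z.1, b • z.2) ∂μ := by
  have hpos : 0 < a ^ Module.finrank ℝ U * b ^ Module.finrank ℝ V := by positivity
  have h := (measurableEmbedding_smul_prod ha.ne' hb.ne').integral_map (μ := μ) g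
  rwa [map_smul_prod_addHaar μ ha hb, integral_smul_measure,
    ENNReal.toReal_ofReal (inv_pos.2 hpos).le, smul_eq_mul, inv_mul_eq_iff_eq_mul₀ hpos.ne'] at h

theorem MeasureTheory.Integrable.comp_smul_prod {U V : Type*}
    [NormedAddCommGroup U] [NormedSpace ℝ U] [FiniteDimensional ℝ U] [MeasurableSpace U]
    [BorelSpace U] [NormedAddCommGroup V] [NormedSpace ℝ V] [FiniteDimensional ℝ V]
    [MeasurableSpace V] [BorelSpace V] {μ : Measure (U × V)} [μ.IsAddHaarMeasure]
    {g : U × V → ℝ} (hg : Integrable g μ) {a b : ℝ} (ha : 0 < a) (hb : 0 < b) :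
    Integrable (fun z => g (a • z.1, b • z.2)) μ := by
  refine ((measurableEmbedding_smul_prod ha.ne' hb.ne').integrable_map_iff (g := g)).1 ?_
  rw [map_smul_prod_addHaar μ ha hb]
  exact hg.smul_measure ENNReal.ofReal_ne_top

/-- The union over `t ∈ [0, 1]` of the slices `{t} × (1 - t) • A × t • B`. -/
def joinSet {U V : Type*} [AddCommGroup U] [Module ℝ U] [AddCommGroup V] [Module ℝ V]
    (A : Set U) (B : Set V) : Set (ℝ × U × V) :=
  (fun z : ℝ × U × V => (z.1, (1 - z.1) • z.2.1, z.1 • z.2.2)) '' (Set.Icc 0 1 ×ˢ A ×ˢ B)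

theorem mem_joinSet_iff {U V : Type*} [AddCommGroup U] [Module ℝ U] [AddCommGroup V] [Module ℝ V]
    {A : Set U} {B : Set V} {t : ℝ} (ht : t ∈ Set.Ioo (0 : ℝ) 1) (a : U) (b : V) :
    (t, (1 - t) • a, t • b) ∈ joinSet A B ↔ a ∈ A ∧ b ∈ B := by
  constructor
  · rintro ⟨⟨s, a', b'⟩, ⟨-, ha, hb⟩, h⟩
    simp only [Prod.mk.injEq] at h
    obtain ⟨rfl, h₁, h₂⟩ := h
    rw [← smul_right_injective U (sub_pos.2 ht.2).ne' h₁, ← smul_right_injective V ht.1.ne' h₂]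
    exact ⟨ha, hb⟩
  · rintro ⟨ha, hb⟩
    exact ⟨(t, a, b), ⟨Set.Ioo_subset_Icc_self ht, ha, hb⟩, rfl⟩

theorem fst_mem_Icc_of_mem_joinSet {U V : Type*} [AddCommGroup U] [Module ℝ U] [AddCommGroup V]
    [Module ℝ V] {A : Set U} {B : Set V} {z : ℝ × U × V} (hz : z ∈ joinSet A B) :
    z.1 ∈ Set.Icc (0 : ℝ) 1 := by
  obtain ⟨w, hw, rfl⟩ := hz
  exact hw.1

theorem IsCompact.joinSet {U V : Type*} [NormedAddCommGroup U] [NormedSpace ℝ U]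
    [NormedAddCommGroup V] [NormedSpace ℝ V] {A : Set U} {B : Set V} (hA : IsCompact A)
    (hB : IsCompact B) : IsCompact (joinSet A B) :=
  (isCompact_Icc.prod (hA.prod hB)).image (by fun_prop)

/-- If `F` is bounded on the slices of `joinSet A B` by the interpolation of `G` and `H`, then so is
its integral. -/
theorem integral_joinSet_le {U V : Type*}
    [NormedAddCommGroup U] [NormedSpace ℝ U] [FiniteDimensional ℝ U] [MeasurableSpace U]
    [BorelSpace U] [NormedAddCommGroup V] [NormedSpace ℝ V] [FiniteDimensional ℝ V]
    [MeasurableSpace V] [BorelSpace V]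
    (μ : Measure U) [μ.IsAddHaarMeasure] (ν : Measure V) [ν.IsAddHaarMeasure]
    {A : Set U} {B : Set V} (hA : IsCompact A) (hB : IsCompact B)
    {F : ℝ × U × V → ℝ} {G : U → ℝ} {H : V → ℝ}
    (hF : IntegrableOn F (joinSet A B) (volume.prod (μ.prod ν))) (hG : IntegrableOn G A μ)
    (hH : IntegrableOn H B ν)
    (hle : ∀ t ∈ Set.Ioo (0 : ℝ) 1, ∀ a ∈ A, ∀ b ∈ B,
      F (t, (1 - t) • a, t • b) ≤ (1 - t) * G a + t * H b) :
    ∫ z in joinSet A B, F z ∂(volume.prod (μ.prod ν)) ≤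
      (∫ t in (0 : ℝ)..1, (1 - t) ^ (Module.finrank ℝ U + 1) * t ^ Module.finrank ℝ V) *
        (ν.real B * ∫ a in A, G a ∂μ) +
      (∫ t in (0 : ℝ)..1, (1 - t) ^ Module.finrank ℝ U * t ^ (Module.finrank ℝ V + 1)) *
        (μ.real A * ∫ b in B, H b ∂ν) := by
  set k := Module.finrank ℝ U
  set l := Module.finrank ℝ V
  set C := joinSet A B
  have hC : IsCompact C := hA.joinSet hB
  have hFi : Integrable (C.indicator F) (volume.prod (μ.prod ν)) :=
    hF.integrable_indicator hC.measurableSet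
  have hAfin : IsFiniteMeasure (μ.restrict A) := ⟨by simpa using hA.measure_lt_top⟩
  have hBfin : IsFiniteMeasure (ν.restrict B) := ⟨by simpa using hB.measure_lt_top⟩
  have hGp : Integrable (fun z : U × V => G z.1) ((μ.restrict A).prod (ν.restrict B)) :=
    hG.integrable.comp_fst _
  have hHp : Integrable (fun z : U × V => H z.2) ((μ.restrict A).prod (ν.restrict B)) :=
    hH.integrable.comp_snd _
  have hGint : ∫ z, G z.1 ∂((μ.restrict A).prod (ν.restrict B)) = ν.real B * ∫ a in A, G a ∂μ := by
    rw [integral_fun_fst]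
    simp
  have hHint : ∫ z, H z.2 ∂((μ.restrict A).prod (ν.restrict B)) = μ.real A * ∫ b in B, H b ∂ν := by
    rw [integral_fun_snd]
    simp
  set I := ν.real B * ∫ a in A, G a ∂μ
  set J := μ.real A * ∫ b in B, H b ∂ν
  let P : ℝ → ℝ := fun t => (1 - t) ^ (k + 1) * t ^ l * I + (1 - t) ^ k * t ^ (l + 1) * J
  have hP : Continuous P := by fun_prop
  rw [← integral_indicator hC.measurableSet, integral_prod _ hFi]
  have hrhs : (∫ t in (0 : ℝ)..1, (1 - t) ^ (k + 1) * t ^ l) * I +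
      (∫ t in (0 : ℝ)..1, (1 - t) ^ k * t ^ (l + 1)) * J =
      ∫ t, (Set.Ioo (0 : ℝ) 1).indicator P t := by
    rw [integral_indicator measurableSet_Ioo, ← integral_Ioc_eq_integral_Ioo,
      ← intervalIntegral.integral_of_le zero_le_one, intervalIntegral.integral_add,
      intervalIntegral.integral_mul_const, intervalIntegral.integral_mul_const]
    all_goals exact Continuous.intervalIntegrable (by fun_prop) _ _
  rw [hrhs]
  refine integral_mono_ae hFi.integral_prod_left ?_ ?_
  · exact (hP.integrableOn_Icc.mono_set Set.Ioo_subset_Icc_self).integrable_indicator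
      measurableSet_Ioo
  filter_upwards [hFi.prod_right_ae, Measure.ae_ne volume 0, Measure.ae_ne volume 1]
    with t ht ht0 ht1
  by_cases ht01 : t ∈ Set.Ioo (0 : ℝ) 1
  · rw [Set.indicator_of_mem ht01]
    have h1t : 0 < 1 - t := sub_pos.2 ht01.2
    rw [integral_eq_mul_integral_comp_smul_prod (μ.prod ν) h1t ht01.1]
    have hind : (fun z : U × V => C.indicator F (t, (1 - t) • z.1, t • z.2)) =
        (A ×ˢ B).indicator fun z => F (t, (1 - t) • z.1, t • z.2) := by
      funext z
      by_cases hz : z ∈ A ×ˢ B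
      · rw [Set.indicator_of_mem hz, Set.indicator_of_mem ((mem_joinSet_iff ht01 _ _).2 hz)]
      · rw [Set.indicator_of_notMem hz,
          Set.indicator_of_notMem fun h => hz ((mem_joinSet_iff ht01 _ _).1 h)]
    have hAB : MeasurableSet (A ×ˢ B) := hA.measurableSet.prod hB.measurableSet
    have hbound : ∫ z : U × V, C.indicator F (t, (1 - t) • z.1, t • z.2) ∂(μ.prod ν) ≤
        (1 - t) * I + t * J := by
      rw [hind, integral_indicator hAB, ← Measure.prod_restrict, ← hGint, ← hHint,
        ← integral_const_mul, ← integral_const_mul, ← integral_add (hGp.const_mul _)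
        (hHp.const_mul _)]
      refine integral_mono_ae ?_ ((hGp.const_mul _).add (hHp.const_mul _)) ?_
      · have hint := ht.comp_smul_prod h1t ht01.1
        rwa [hind, integrable_indicator_iff hAB, IntegrableOn, ← Measure.prod_restrict] at hint
      · rw [Measure.prod_restrict]
        filter_upwards [ae_restrict_mem hAB] with z hz
        exact hle t ht01 _ hz.1 _ hz.2
    calc _ ≤ (1 - t) ^ k * t ^ l * ((1 - t) * I + t * J) := by
          have := ht01.1
          gcongr
      _ = P t := by simp only [P]; ring
  · rw [Set.indicator_of_notMem ht01]
    refine (integral_eq_zero_of_ae (Filter.Eventually.of_forall fun z => ?_)).le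
    refine Set.indicator_of_notMem (fun h => ht01 ?_) _
    have := fst_mem_Icc_of_mem_joinSet h
    exact ⟨lt_of_le_of_ne this.1 (Ne.symm ht0), lt_of_le_of_ne this.2 ht1⟩

theorem integral_one_sub_pow_mul_pow_pos (k l : ℕ) :
    0 < ∫ t in (0 : ℝ)..1, (1 - t) ^ k * t ^ l := by
  refine intervalIntegral.intervalIntegral_pos_of_pos_on
    (Continuous.intervalIntegrable (by fun_prop) _ _) (fun t ht => ?_) zero_lt_one
  have := sub_pos.2 ht.2
  have := ht.1
  positivity

theorem integral_one_sub_pow_succ_mul_pow_add (k l : ℕ) :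
    (∫ t in (0 : ℝ)..1, (1 - t) ^ (k + 1) * t ^ l) + ∫ t in (0 : ℝ)..1, (1 - t) ^ k * t ^ (l + 1) =
      ∫ t in (0 : ℝ)..1, (1 - t) ^ k * t ^ l := by
  rw [← intervalIntegral.integral_add]
  · congr 1
    funext t
    ring
  all_goals exact Continuous.intervalIntegrable (by fun_prop) _ _

theorem integral_one_sub_pow_mul_pow_succ_symm (k l : ℕ) :
    (l + 1 : ℝ) * ∫ t in (0 : ℝ)..1, (1 - t) ^ (k + 1) * t ^ l =
      (k + 1 : ℝ) * ∫ t in (0 : ℝ)..1, (1 - t) ^ k * t ^ (l + 1) := by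
  rw [← sub_eq_zero, ← intervalIntegral.integral_const_mul, ← intervalIntegral.integral_const_mul,
    ← intervalIntegral.integral_sub]
  · have hderiv : ∀ t ∈ Set.uIcc (0 : ℝ) 1, HasDerivAt (fun t : ℝ => (1 - t) ^ (k + 1) * t ^ (l + 1))
        ((l + 1 : ℝ) * ((1 - t) ^ (k + 1) * t ^ l) - (k + 1 : ℝ) * ((1 - t) ^ k * t ^ (l + 1))) t := by
      intro t _
      convert! (((hasDerivAt_id t).const_sub 1).pow (k + 1)).mul
        ((hasDerivAt_id t).pow (l + 1)) using 1
      simp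
      ring
    rw [intervalIntegral.integral_eq_sub_of_hasDerivAt hderiv
      (Continuous.intervalIntegrable (by fun_prop) _ _)]
    simp
  all_goals exact Continuous.intervalIntegrable (by fun_prop) _ _

/-- The face of a nondegenerate simplex on `k + 1` vertices is the affine image of a convex body
in `ℝᵏ`. -/
theorem AffineIndependent.exists_affineMap_image_eq_convexHull {ι E : Type*}
    [NormedAddCommGroup E] [NormedSpace ℝ E] {x : ι → E} (hx : AffineIndependent ℝ x)
    {K : Finset ι} {k : ℕ} (hK : K.card = k + 1) :
    ∃ φ : (Fin k → ℝ) →ᵃ[ℝ] E, Function.Injective φ ∧ ∃ A : Set (Fin k → ℝ),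
      φ '' A = convexHull ℝ (x '' K) ∧ IsCompact A ∧ Convex ℝ A ∧ (interior A).Nonempty := by
  classical
  obtain ⟨i₀, hi₀⟩ : K.Nonempty := Finset.card_pos.1 (by omega)
  have hfin := hx.finrank_vectorSpan_image_finset hK
  rw [Finset.coe_image] at hfin
  have hfd : FiniteDimensional ℝ (vectorSpan ℝ (x '' K)) :=
    finiteDimensional_vectorSpan_of_finite ℝ (K.finite_toSet.image x)
  let e : (Fin k → ℝ) ≃ₗ[ℝ] vectorSpan ℝ (x '' K) :=
    LinearEquiv.ofFinrankEq _ _ (by rw [hfin]; simp)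
  let φ : (Fin k → ℝ) →ᵃ[ℝ] E :=
    ((vectorSpan ℝ (x '' K)).subtype ∘ₗ e.toLinearMap).toAffineMap + AffineMap.const ℝ _ (x i₀)
  have hφ : ∀ u, φ u = (e u : E) + x i₀ := fun u => rfl
  let ψ : K → Fin k → ℝ := fun i =>
    e.symm ⟨x i - x i₀, vsub_mem_vectorSpan ℝ ⟨i, i.2, rfl⟩ ⟨i₀, hi₀, rfl⟩⟩
  have hφψ : φ ∘ ψ = fun i : K => x i := by
    funext i
    simp [hφ, ψ]
  have hψ : AffineIndependent ℝ ψ := by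
    refine AffineIndependent.of_comp φ ?_
    rw [hφψ]
    exact hx.comp_embedding (Function.Embedding.subtype _)
  refine ⟨φ, fun u v h => ?_, convexHull ℝ (Set.range ψ), ?_,
    (Set.finite_range ψ).isCompact_convexHull _, convex_convexHull ℝ _, ?_⟩
  · simpa [hφ] using h
  · rw [AffineMap.image_convexHull, ← Set.range_comp, hφψ]
    congr 1
    ext y
    simp
  · rw [interior_convexHull_nonempty_iff_affineSpan_eq_top,
      hψ.affineSpan_eq_top_iff_card_eq_finrank_add_one]
    simp [hK]

/-- The affine map `(t, p, q) ↦ (1 - t) φ(0) + t ψ(0) + φ.linear p + ψ.linear q`, which sends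
`(t, (1 - t) • a, t • b)` to `(1 - t) • φ a + t • ψ b`. -/
noncomputable def AffineMap.join {U V E : Type*} [AddCommGroup U] [Module ℝ U] [AddCommGroup V]
    [Module ℝ V] [AddCommGroup E] [Module ℝ E] (φ : U →ᵃ[ℝ] E) (ψ : V →ᵃ[ℝ] E) :
    ℝ × U × V →ᵃ[ℝ] E :=
  ((LinearMap.toSpanSingleton ℝ E (ψ 0 - φ 0)).coprod
    (φ.linear.coprod ψ.linear)).toAffineMap + AffineMap.const ℝ _ (φ 0)

theorem AffineMap.join_apply_smul {U V E : Type*} [AddCommGroup U] [Module ℝ U] [AddCommGroup V]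
    [Module ℝ V] [AddCommGroup E] [Module ℝ E] (φ : U →ᵃ[ℝ] E) (ψ : V →ᵃ[ℝ] E)
    (t : ℝ) (a : U) (b : V) :
    φ.join ψ (t, (1 - t) • a, t • b) = (1 - t) • φ a + t • ψ b := by
  have ha : φ a = φ.linear a + φ 0 := by simpa using φ.map_vadd 0 a
  have hb : ψ b = ψ.linear b + ψ 0 := by simpa using ψ.map_vadd 0 b
  simp only [AffineMap.join, AffineMap.coe_add, Pi.add_apply, LinearMap.coe_toAffineMap,
    LinearMap.coprod_apply, LinearMap.toSpanSingleton_apply, map_smul, AffineMap.const_apply]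
  rw [ha, hb]
  module

theorem AffineMap.join_image_joinSet {U V E : Type*} [AddCommGroup U] [Module ℝ U]
    [AddCommGroup V] [Module ℝ V] [AddCommGroup E] [Module ℝ E] (φ : U →ᵃ[ℝ] E) (ψ : V →ᵃ[ℝ] E)
    (A : Set U) (B : Set V) :
    φ.join ψ '' joinSet A B = convexJoin ℝ (φ '' A) (ψ '' B) := by
  ext y
  simp only [joinSet, Set.image_image, AffineMap.join_apply_smul, mem_convexJoin,
    segment_eq_image, Set.exists_mem_image]
  constructor
  · rintro ⟨⟨t, a, b⟩, ⟨ht, ha, hb⟩, rfl⟩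
    exact ⟨a, ha, b, hb, t, ht, rfl⟩
  · rintro ⟨a, ha, b, hb, t, ht, rfl⟩
    exact ⟨(t, a, b), ⟨ht, ha, hb⟩, rfl⟩

/-- An affine map from a `d`-dimensional space whose range contains `d + 1` affinely independent
points is injective. -/
theorem AffineMap.injective_of_affineIndependent {ι W E : Type*} [AddCommGroup W] [Module ℝ W]
    [FiniteDimensional ℝ W] [AddCommGroup E] [Module ℝ E] (φ : W →ᵃ[ℝ] E) {x : ι → E}
    (hx : AffineIndependent ℝ x) {S : Finset ι} (hS : S.card = Module.finrank ℝ W + 1)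
    (hsub : x '' S ⊆ Set.range φ) : Function.Injective φ := by
  classical
  have hfin := hx.finrank_vectorSpan_image_finset hS
  rw [Finset.coe_image] at hfin
  have hle : vectorSpan ℝ (x '' S) ≤ LinearMap.range φ.linear := by
    refine (vectorSpan_mono ℝ hsub).trans ?_
    rw [← Set.image_univ, ← AffineMap.map_vectorSpan]
    exact LinearMap.map_le_range
  have h₁ := Submodule.finrank_mono hle
  have h₂ := φ.linear.finrank_range_add_finrank_ker
  rw [← φ.linear_injective_iff, ← LinearMap.ker_eq_bot, ← Submodule.finrank_eq_zero (R := ℝ)]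
  omega

/-- The volume of a join. -/
theorem measureReal_joinSet {U V : Type*}
    [NormedAddCommGroup U] [NormedSpace ℝ U] [FiniteDimensional ℝ U] [MeasurableSpace U]
    [BorelSpace U] [NormedAddCommGroup V] [NormedSpace ℝ V] [FiniteDimensional ℝ V]
    [MeasurableSpace V] [BorelSpace V]
    (μ : Measure U) [μ.IsAddHaarMeasure] (ν : Measure V) [ν.IsAddHaarMeasure]
    {A : Set U} {B : Set V} (hA : IsCompact A) (hB : IsCompact B) :
    (volume.prod (μ.prod ν)).real (joinSet A B) =
      (∫ t in (0 : ℝ)..1, (1 - t) ^ Module.finrank ℝ U * t ^ Module.finrank ℝ V) *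
        (μ.real A * ν.real B) := by
  have hle (c : ℝ) := integral_joinSet_le μ ν hA hB (F := fun _ => c) (G := fun _ => c)
    (H := fun _ => c) (integrableOn_const (hA.joinSet hB).measure_lt_top.ne)
    (integrableOn_const hA.measure_lt_top.ne) (integrableOn_const hB.measure_lt_top.ne)
    (fun t _ a _ b _ => by linarith)
  have h₁ := hle 1
  have h₂ := hle (-1)
  simp only [setIntegral_const, smul_eq_mul] at h₁ h₂
  rw [← integral_one_sub_pow_succ_mul_pow_add]
  linarith

/-- The average over a join is at most the weighted mean of the averages over its factors. -/
theorem setAverage_joinSet_le {U V : Type*}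
    [NormedAddCommGroup U] [NormedSpace ℝ U] [FiniteDimensional ℝ U] [MeasurableSpace U]
    [BorelSpace U] [NormedAddCommGroup V] [NormedSpace ℝ V] [FiniteDimensional ℝ V]
    [MeasurableSpace V] [BorelSpace V]
    (μ : Measure U) [μ.IsAddHaarMeasure] (ν : Measure V) [ν.IsAddHaarMeasure]
    {A : Set U} {B : Set V} (hA : IsCompact A) (hB : IsCompact B)
    (hA' : (interior A).Nonempty) (hB' : (interior B).Nonempty)
    {F : ℝ × U × V → ℝ} {G : U → ℝ} {H : V → ℝ}
    (hF : IntegrableOn F (joinSet A B) (volume.prod (μ.prod ν))) (hG : IntegrableOn G A μ)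
    (hH : IntegrableOn H B ν)
    (hle : ∀ t ∈ Set.Ioo (0 : ℝ) 1, ∀ a ∈ A, ∀ b ∈ B,
      F (t, (1 - t) • a, t • b) ≤ (1 - t) * G a + t * H b)
    {k l : ℕ} (hk : Module.finrank ℝ U = k) (hl : Module.finrank ℝ V = l) :
    ⨍ z in joinSet A B, F z ∂(volume.prod (μ.prod ν)) ≤
      ((k : ℝ) + 1) / ((k : ℝ) + l + 2) * (⨍ a in A, G a ∂μ) +
        ((l : ℝ) + 1) / ((k : ℝ) + l + 2) * ⨍ b in B, H b ∂ν := by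
  have hA0 : 0 < μ.real A := ENNReal.toReal_pos
    (Measure.measure_pos_of_nonempty_interior μ hA').ne' hA.measure_lt_top.ne
  have hB0 : 0 < ν.real B := ENNReal.toReal_pos
    (Measure.measure_pos_of_nonempty_interior ν hB').ne' hB.measure_lt_top.ne
  have hmain := integral_joinSet_le μ ν hA hB hF hG hH hle
  rw [setAverage_eq, setAverage_eq, setAverage_eq, measureReal_joinSet μ ν hA hB]
  simp only [hk, hl, smul_eq_mul] at hmain ⊢
  have hpos := integral_one_sub_pow_mul_pow_pos k l
  have hadd := integral_one_sub_pow_succ_mul_pow_add k l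
  have hsymm := integral_one_sub_pow_mul_pow_succ_symm k l
  set β := ∫ t in (0 : ℝ)..1, (1 - t) ^ k * t ^ l
  set β₁ := ∫ t in (0 : ℝ)..1, (1 - t) ^ (k + 1) * t ^ l
  set β₂ := ∫ t in (0 : ℝ)..1, (1 - t) ^ k * t ^ (l + 1)
  have hkl : (0 : ℝ) < k + l + 2 := by positivity
  have h₁ : β₁ = (k + 1) / (k + l + 2) * β := by
    field_simp
    linear_combination (-(k + 1 : ℝ)) * hadd.symm + hsymm
  have h₂ : β₂ = (l + 1) / (k + l + 2) * β := by
    field_simp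
    linear_combination (-(l + 1 : ℝ)) * hadd.symm - hsymm
  rw [inv_mul_le_iff₀ (by positivity)]
  refine hmain.trans (le_of_eq ?_)
  rw [h₁, h₂]
  field_simp

theorem avg_face_union_le (n k l : ℕ) (x : Fin (n + 1) → EuclideanSpace ℝ (Fin n))
    (hx : AffineIndependent ℝ x) (K L : Finset (Fin (n + 1))) (hKL : Disjoint K L)
    (hK : K.card = k + 1) (hL : L.card = l + 1) (f : EuclideanSpace ℝ (Fin n) → ℝ)
    (hf : ConvexOn ℝ (convexHull ℝ (Set.range x)) f) :
    avgH f ((k : ℝ) + l + 1) (convexHull ℝ (x '' ↑(K ∪ L))) ≤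
      ((k : ℝ) + 1) / ((k : ℝ) + l + 2) * avgH f (k : ℝ) (convexHull ℝ (x '' ↑K)) +
        ((l : ℝ) + 1) / ((k : ℝ) + l + 2) * avgH f (l : ℝ) (convexHull ℝ (x '' ↑L)) := by
  obtain ⟨φ, hφ, A, hφA, hA, hAconv, hAint⟩ := hx.exists_affineMap_image_eq_convexHull hK
  obtain ⟨ψ, hψ, B, hψB, hB, hBconv, hBint⟩ := hx.exists_affineMap_image_eq_convexHull hL
  have hK0 : (x '' (K : Set (Fin (n + 1)))).Nonempty :=
    (Finset.coe_nonempty.2 (Finset.card_pos.1 (by omega))).image x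
  have hL0 : (x '' (L : Set (Fin (n + 1)))).Nonempty :=
    (Finset.coe_nonempty.2 (Finset.card_pos.1 (by omega))).image x
  have himage : φ.join ψ '' joinSet A B = convexHull ℝ (x '' ↑(K ∪ L)) := by
    rw [AffineMap.join_image_joinSet, hφA, hψB, Finset.coe_union, Set.image_union,
      convexHull_union hK0 hL0]
  have hinj : Function.Injective (φ.join ψ) := by
    refine AffineMap.injective_of_affineIndependent _ hx (S := K ∪ L) ?_ ?_
    · rw [Finset.card_union_of_disjoint hKL, hK, hL]
      simp
      omega
    · exact (subset_convexHull ℝ _).trans (himage ▸ Set.image_subset_range _ _)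
  have hbdd : BddAbove (f '' convexHull ℝ (Set.range x)) :=
    hf.bddAbove_convexHull (subset_convexHull ℝ _) ((Set.finite_range x).image f).bddAbove
  have hface (S : Finset (Fin (n + 1))) : convexHull ℝ (x '' S) ⊆ convexHull ℝ (Set.range x) :=
    convexHull_mono (Set.image_subset_range _ _)
  have hjoin : Convex ℝ (joinSet A B) := by
    rw [← hinj.preimage_image (joinSet A B), himage]
    exact (convex_convexHull ℝ _).affine_preimage _
  have hint {W : Type} [NormedAddCommGroup W] [NormedSpace ℝ W] [FiniteDimensional ℝ W]
      [MeasurableSpace W] [BorelSpace W] (μ : Measure W) [μ.IsAddHaarMeasure]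
      (χ : W →ᵃ[ℝ] EuclideanSpace ℝ (Fin n)) {C : Set W} {S : Finset (Fin (n + 1))}
      (hχ : χ '' C = convexHull ℝ (x '' S)) (hC : IsCompact C) (hconv : Convex ℝ C) :
      IntegrableOn (fun w => f (χ w)) C μ := by
    have hsub : χ '' C ⊆ convexHull ℝ (Set.range x) := hχ.trans_subset (hface S)
    refine ((hf.comp_affineMap χ).subset (Set.image_subset_iff.1 hsub)
      hconv).integrableOn_of_bddAbove μ hC (hbdd.mono ?_)
    rw [Set.image_comp]
    exact Set.image_mono hsub
  let ν : Measure ((Fin k → ℝ) × (Fin l → ℝ)) := volume.prod volume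
  have hν : ν.IsAddHaarMeasure := Measure.prod.instIsAddHaarMeasure _ _
  let μ : Measure (ℝ × (Fin k → ℝ) × (Fin l → ℝ)) := volume.prod ν
  have hμ : μ.IsAddHaarMeasure := Measure.prod.instIsAddHaarMeasure _ _
  simp only [avgH, ← himage, ← hφA, ← hψB]
  rw [setAverage_hausdorffMeasure_image_affineMap μ hinj (by simp; ring),
    setAverage_hausdorffMeasure_image_affineMap volume hφ (by simp),
    setAverage_hausdorffMeasure_image_affineMap volume hψ (by simp)]
  refine setAverage_joinSet_le volume volume hA hB hAint hBint
    (hint μ _ himage (hA.joinSet hB) hjoin) (hint _ φ hφA hA hAconv) (hint _ ψ hψB hB hBconv)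
    (fun t ht a ha b hb => ?_) (by simp) (by simp)
  rw [AffineMap.join_apply_smul]
  exact hf.2 (hface K (hφA ▸ Set.mem_image_of_mem φ ha)) (hface L (hψB ▸ Set.mem_image_of_mem ψ hb))
    (sub_pos.2 ht.2).le ht.1.le (by ring)
end

section
/- Let 𝒦 = {K₁,…,K_p} be a partition of N = {0,…,n} and define F(𝒦) = Σᵢ |Kᵢ| · Avg(f, Δ_{Kᵢ}) for a convex function f : Δ → ℝ on a nondegenerate simplex Δ with vertex set indexed by N. If a partition ℒ refines 𝒦 (every element of ℒ is contained in an element of 𝒦), then F(𝒦) ≤ F(ℒ). -/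
open MeasureTheory

/-- `P` is a partition of `{0, …, m-1}` into pairwise disjoint nonempty subsets. -/
def IsPartition {m : ℕ} (P : Finset (Finset (Fin m))) : Prop :=
  (∀ K ∈ P, K.Nonempty) ∧ (P : Set (Finset (Fin m))).PairwiseDisjoint id ∧
    P.sup id = Finset.univ

open ProbabilityTheory

theorem lintegral_pi_fin_succ {m : ℕ} (ν : Measure ℝ) [SigmaFinite ν]
    {F : (Fin (m + 1) → ℝ) → ENNReal} (hF : Measurable F) :
    ∫⁻ t, F t ∂Measure.pi (fun _ => ν) =
      ∫⁻ a, ∫⁻ v, F (Fin.cons a v) ∂Measure.pi (fun _ => ν) ∂ν := by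
  have h := (measurePreserving_piFinSuccAbove (fun _ : Fin (m + 1) => ν) 0).symm
  rw [← h.lintegral_comp hF, lintegral_prod]
  · simp [MeasurableEquiv.piFinSuccAbove_symm_apply, Fin.insertNthEquiv, Fin.insertNth_zero']
  · exact (hF.comp h.measurable).aemeasurable

theorem measurable_fin_cons {m : ℕ} :
    Measurable fun p : ℝ × (Fin m → ℝ) => (Fin.cons p.1 p.2 : Fin (m + 1) → ℝ) := by
  refine measurable_pi_iff.2 fun i => ?_
  refine Fin.cases ?_ (fun j => ?_) i
  · simpa using measurable_fst
  · simp only [Fin.cons_succ]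
    fun_prop

theorem lintegral_pi_withDensity {m : ℕ} (ν : Measure ℝ) [SigmaFinite ν] {w : ℝ → ENNReal}
    (hw : Measurable w) [SigmaFinite (ν.withDensity w)]
    {F : (Fin m → ℝ) → ENNReal} (hF : Measurable F) :
    ∫⁻ t, F t ∂Measure.pi (fun _ => ν.withDensity w) =
      ∫⁻ t, F t * ∏ i, w (t i) ∂Measure.pi (fun _ => ν) := by
  induction m with
  | zero => rw [Measure.pi_of_empty, Measure.pi_of_empty]; simp
  | succ m ih =>
    have hc := hF.comp (measurable_fin_cons (m := m))
    have hca (a : ℝ) : Measurable fun v : Fin m → ℝ => F (Fin.cons a v) :=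
      hc.comp measurable_prodMk_left
    rw [lintegral_pi_fin_succ _ hF, lintegral_pi_fin_succ _ (by fun_prop)]
    simp_rw [ih (hca _)]
    rw [lintegral_withDensity_eq_lintegral_mul _ hw]
    · refine lintegral_congr fun a => ?_
      rw [Pi.mul_apply, ← lintegral_const_mul]
      · refine lintegral_congr fun v => ?_
        simp only [Fin.prod_univ_succ, Fin.cons_zero, Fin.cons_succ]
        ring
      · exact (hca a).mul (by fun_prop)
    · exact Measurable.lintegral_prod_right'
        (f := fun p : ℝ × (Fin m → ℝ) => F (Fin.cons p.1 p.2) * ∏ i, w (p.2 i))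
        (hc.mul (by fun_prop))

/-- The solid simplex spanned by the origin and the standard basis vectors. -/
def solidSimplex (d : ℕ) : Set (Fin d → ℝ) := {u | (∀ i, 0 ≤ u i) ∧ ∑ i, u i ≤ 1}

theorem measurableSet_solidSimplex (d : ℕ) : MeasurableSet (solidSimplex d) := by
  unfold solidSimplex
  measurability

theorem measurable_exponentialPDF (r : ℝ) : Measurable (exponentialPDF r) := by
  unfold exponentialPDF
  exact (measurable_exponentialPDFReal r).ennreal_ofReal

theorem exponentialPDF_one (t : ℝ) :
    exponentialPDF 1 t = if 0 ≤ t then ENNReal.ofReal (Real.exp (-t)) else 0 := by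
  rw [exponentialPDF_eq]
  split_ifs <;> simp

theorem prod_exponentialPDF_one {d : ℕ} (v : Fin d → ℝ) :
    ∏ i, exponentialPDF 1 (v i) =
      if ∀ i, 0 ≤ v i then ENNReal.ofReal (Real.exp (-∑ i, v i)) else 0 := by
  split_ifs with h
  · simp_rw [exponentialPDF_one, h, if_true, ← Finset.sum_neg_distrib, Real.exp_sum]
    exact (ENNReal.ofReal_prod_of_nonneg fun i _ => (Real.exp_pos _).le).symm
  · push Not at h
    obtain ⟨i, hi⟩ := h
    exact Finset.prod_eq_zero (Finset.mem_univ i) (by simp [exponentialPDF_one, hi])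

/-- Normalizing independent exponential variables, weighted by their sum, yields a multiple of
Lebesgue measure on the solid simplex. -/
theorem exists_lintegral_exp_eq_mul_setLIntegral_solidSimplex (d : ℕ) :
    ∃ C : ENNReal, ∀ h : (Fin d → ℝ) → ENNReal, Measurable h →
      ∫⁻ t : Fin (d + 1) → ℝ, ENNReal.ofReal (∑ i, t i) * h (fun i => t i.succ / ∑ j, t j)
        ∂Measure.pi (fun _ => expMeasure 1) = C * ∫⁻ u in solidSimplex d, h u := by
  refine ⟨∫⁻ r : ℝ, ENNReal.ofReal (r * Real.exp (-r)) * ENNReal.ofReal |((r⁻¹) ^ d)⁻¹|,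
    fun h hh => ?_⟩
  classical
  have hw := measurable_exponentialPDF 1
  have hρ : expMeasure 1 = volume.withDensity (exponentialPDF 1) := rfl
  have : SigmaFinite (volume.withDensity (exponentialPDF 1)) := by
    have := isProbabilityMeasure_expMeasure one_pos
    rw [← hρ]; infer_instance
  have hG : Measurable fun t : Fin (d + 1) → ℝ =>
      ENNReal.ofReal (∑ i, t i) * h (fun i => t i.succ / ∑ j, t j) := by
    refine Measurable.mul (by fun_prop) (hh.comp ?_)
    fun_prop
  have hF : Measurable fun t : Fin (d + 1) → ℝ =>
      ENNReal.ofReal (∑ i, t i) * h (fun i => t i.succ / ∑ j, t j) *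
        ∏ i, exponentialPDF 1 (t i) := hG.mul (by fun_prop)
  have hg : Measurable ((solidSimplex d).indicator h) :=
    hh.indicator (measurableSet_solidSimplex d)
  rw [hρ, lintegral_pi_withDensity _ hw hG, lintegral_pi_fin_succ _ hF]
  rw [lintegral_lintegral_swap (f := fun a v => (fun t : Fin (d + 1) → ℝ =>
      ENNReal.ofReal (∑ i, t i) * h (fun i => t i.succ / ∑ j, t j) *
        ∏ i, exponentialPDF 1 (t i)) (Fin.cons a v))
      (hF.comp measurable_fin_cons).aemeasurable]
  have key (r : ℝ) (v : Fin d → ℝ) :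
      ENNReal.ofReal (∑ i, (Fin.cons (r - ∑ i, v i) v : Fin (d + 1) → ℝ) i) *
        h (fun i => (Fin.cons (r - ∑ i, v i) v : Fin (d + 1) → ℝ) i.succ /
          ∑ j, (Fin.cons (r - ∑ i, v i) v : Fin (d + 1) → ℝ) j) *
        ∏ i, exponentialPDF 1 ((Fin.cons (r - ∑ i, v i) v : Fin (d + 1) → ℝ) i) =
      ENNReal.ofReal (r * Real.exp (-r)) * (solidSimplex d).indicator h (r⁻¹ • v) := by
    simp only [Fin.sum_univ_succ, Fin.prod_univ_succ, Fin.cons_zero, Fin.cons_succ,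
      sub_add_cancel]
    rcases le_or_gt r 0 with hr | hr
    · rw [ENNReal.ofReal_of_nonpos hr, ENNReal.ofReal_of_nonpos
        (mul_nonpos_of_nonpos_of_nonneg hr (Real.exp_pos _).le)]
      simp
    · have hmem : r⁻¹ • v ∈ solidSimplex d ↔ (∀ i, 0 ≤ v i) ∧ ∑ i, v i ≤ r := by
        simp only [solidSimplex, Set.mem_ofPred_eq, Pi.smul_apply, smul_eq_mul,
          ← Finset.mul_sum, inv_mul_le_one₀ hr, mul_nonneg_iff_of_pos_left (inv_pos.2 hr)]
      have hv : (fun i => v i / r) = r⁻¹ • v := by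
        ext i; simp [div_eq_inv_mul]
      rw [hv, prod_exponentialPDF_one, exponentialPDF_one, Set.indicator_apply]
      simp only [hmem, sub_nonneg]
      by_cases h1 : ∀ i, 0 ≤ v i <;> by_cases h2 : ∑ i, v i ≤ r <;> simp only [h1, h2] <;> simp
      rw [← ENNReal.ofReal_mul (Real.exp_pos _).le, ← Real.exp_add,
        ENNReal.ofReal_mul hr.le]
      ring_nf
  have hmeas : Measurable fun p : (Fin d → ℝ) × ℝ =>
      ENNReal.ofReal (p.2 * Real.exp (-p.2)) * (solidSimplex d).indicator h (p.2⁻¹ • p.1) := by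
    refine Measurable.mul (by fun_prop) (hg.comp ?_)
    fun_prop
  calc _ = ∫⁻ v : Fin d → ℝ, ∫⁻ r : ℝ,
        ENNReal.ofReal (r * Real.exp (-r)) * (solidSimplex d).indicator h (r⁻¹ • v) := by
        refine lintegral_congr fun v => ?_
        rw [← lintegral_sub_right_eq_self _ (∑ i, v i)]
        exact lintegral_congr fun r => key r v
    _ = ∫⁻ r : ℝ, ∫⁻ v : Fin d → ℝ,
        ENNReal.ofReal (r * Real.exp (-r)) * (solidSimplex d).indicator h (r⁻¹ • v) :=
        lintegral_lintegral_swap hmeas.aemeasurable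
    _ = _ := by
        rw [← lintegral_mul_const _ (by fun_prop)]
        refine lintegral_congr fun r => ?_
        rcases eq_or_ne r 0 with rfl | hr
        · simp
        have hs : Measurable fun v : Fin d → ℝ => r⁻¹ • v := by fun_prop
        rw [lintegral_const_mul (f := fun v => (solidSimplex d).indicator h (r⁻¹ • v)) _
            (hg.comp hs),
          ← lintegral_map (f := (solidSimplex d).indicator h) hg hs,
          Measure.map_addHaar_smul _ (inv_ne_zero hr), lintegral_smul_measure,
          lintegral_indicator (measurableSet_solidSimplex d)]
        simp [mul_assoc]

/-- The affine map sending the vertices of the solid simplex to the points `y`. -/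
noncomputable def simplexMap {n d : ℕ} (y : Fin (d + 1) → EuclideanSpace ℝ (Fin n))
    (u : Fin d → ℝ) : EuclideanSpace ℝ (Fin n) :=
  y 0 + Fintype.linearCombination ℝ (fun i : Fin d => y i.succ - y 0) u

theorem simplexMap_eq_sum {n d : ℕ} (y : Fin (d + 1) → EuclideanSpace ℝ (Fin n))
    (u : Fin d → ℝ) :
    simplexMap y u = (1 - ∑ i, u i) • y 0 + ∑ i, u i • y i.succ := by
  simp only [simplexMap, Fintype.linearCombination_apply, smul_sub, Finset.sum_sub_distrib,
    sub_smul, one_smul, Finset.sum_smul]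
  abel

theorem convexHull_range_eq_image_stdSimplex {ι E : Type*} [Fintype ι] [AddCommGroup E]
    [Module ℝ E] (v : ι → E) :
    convexHull ℝ (Set.range v) = Fintype.linearCombination ℝ v '' stdSimplex ℝ ι := by
  classical
  rw [← convexHull_rangle_single_eq_stdSimplex, LinearMap.image_convexHull, ← Set.range_comp]
  congr 2
  ext i
  simp

theorem image_simplexMap_solidSimplex {n d : ℕ} (y : Fin (d + 1) → EuclideanSpace ℝ (Fin n)) :
    simplexMap y '' solidSimplex d = convexHull ℝ (Set.range y) := by
  rw [convexHull_range_eq_image_stdSimplex]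
  apply Set.Subset.antisymm
  · rintro _ ⟨u, ⟨hu, hu'⟩, rfl⟩
    refine ⟨Fin.cons (1 - ∑ i, u i) u, ⟨fun i => ?_, ?_⟩, ?_⟩
    · refine Fin.cases ?_ (fun j => ?_) i
      · simpa using hu'
      · simpa using hu j
    · simp [Fin.sum_univ_succ]
    · simp [simplexMap_eq_sum, Fintype.linearCombination_apply, Fin.sum_univ_succ]
  · rintro _ ⟨w, ⟨hw, hw'⟩, rfl⟩
    rw [Fin.sum_univ_succ] at hw'
    refine ⟨fun i => w i.succ, ⟨fun i => hw _, ?_⟩, ?_⟩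
    · linarith [hw 0]
    · rw [simplexMap_eq_sum, Fintype.linearCombination_apply, Fin.sum_univ_succ, ← hw',
        add_sub_cancel_right]

theorem convex_solidSimplex (d : ℕ) : Convex ℝ (solidSimplex d) := by
  rintro u ⟨hu, hu'⟩ v ⟨hv, hv'⟩ a b ha hb hab
  refine ⟨fun i => ?_, ?_⟩
  · have := mul_nonneg ha (hu i)
    have := mul_nonneg hb (hv i)
    simp only [Pi.add_apply, Pi.smul_apply, smul_eq_mul]
    linarith
  · simp only [Pi.add_apply, Pi.smul_apply, smul_eq_mul, Finset.sum_add_distrib,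
      ← Finset.mul_sum]
    nlinarith

theorem linearIndependent_edges {n d : ℕ} {y : Fin (d + 1) → EuclideanSpace ℝ (Fin n)}
    (hy : AffineIndependent ℝ y) : LinearIndependent ℝ fun i : Fin d => y i.succ - y 0 := by
  have h := (affineIndependent_iff_linearIndependent_vsub ℝ y 0).1 hy
  exact h.comp (fun i : Fin d => ⟨i.succ, i.succ_ne_zero⟩)
    fun i j hij => by simpa using hij

theorem measurableEmbedding_simplexMap {n d : ℕ} {y : Fin (d + 1) → EuclideanSpace ℝ (Fin n)}
    (hy : AffineIndependent ℝ y) : MeasurableEmbedding (simplexMap y) := by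
  have hc : Continuous (Fintype.linearCombination ℝ fun i : Fin d => y i.succ - y 0) :=
    LinearMap.continuous_of_finiteDimensional _
  refine Continuous.measurableEmbedding (by unfold simplexMap; fun_prop) fun u v huv => ?_
  exact ((linearIndependent_edges hy).fintypeLinearCombination_injective)
    (add_left_cancel huv)

theorem exists_map_simplexMap_eq_smul_hausdorffMeasure {n d : ℕ}
    {y : Fin (d + 1) → EuclideanSpace ℝ (Fin n)} (hy : AffineIndependent ℝ y) :
    ∃ c : NNReal, (volume.restrict (solidSimplex d)).map (simplexMap y) =
      c • (μH[d] : Measure (EuclideanSpace ℝ (Fin n))).restrict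
        (convexHull ℝ (Set.range y)) := by
  let A := Fintype.linearCombination ℝ fun i : Fin d => y i.succ - y 0
  have hinj : Function.Injective A :=
    (linearIndependent_edges hy).fintypeLinearCombination_injective
  let e : (Fin d → ℝ) ≃L[ℝ] LinearMap.range A :=
    (LinearEquiv.ofInjective A hinj).toContinuousLinearEquiv
  have hrank : Module.finrank ℝ (LinearMap.range A) = d := by
    rw [LinearMap.finrank_range_of_inj hinj]; simp
  have hH : (μH[d] : Measure (LinearMap.range A)).IsAddHaarMeasure := by
    have := isAddHaarMeasure_hausdorffMeasure (E := LinearMap.range A)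
    rwa [hrank] at this
  obtain ⟨c, hvol⟩ : ∃ c : NNReal, (volume : Measure (Fin d → ℝ)).map e = c • μH[d] :=
    ⟨_, Measure.isAddLeftInvariant_eq_smul (volume.map e) μH[d]⟩
  refine ⟨c, ?_⟩
  have hψ : Isometry fun w : LinearMap.range A => y 0 + (w : EuclideanSpace ℝ (Fin n)) :=
    (IsometryEquiv.addLeft (y 0)).isometry.comp isometry_subtype_coe
  have hcomp : simplexMap y = (fun w : LinearMap.range A => y 0 + (w : _)) ∘ e := by
    ext1 u; rfl
  have hmap : volume.map (simplexMap y) = c • μH[d].restrict (Set.range (simplexMap y)) := by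
    rw [hcomp, ← Measure.map_map hψ.continuous.measurable e.continuous.measurable, hvol,
      Measure.map_smul, hψ.map_hausdorffMeasure (Or.inl (by positivity)),
      Set.range_comp, e.surjective.range_eq, Set.image_univ]
  have hemb := measurableEmbedding_simplexMap hy
  have hres := hemb.restrict_map volume (simplexMap y '' solidSimplex d)
  rw [Set.preimage_image_eq _ hemb.injective] at hres
  rw [← hres, hmap, Measure.restrict_smul, Measure.restrict_restrict_of_subset
    (Set.image_subset_range _ _), image_simplexMap_solidSimplex]

theorem aestronglyMeasurable_of_convexOn {n d : ℕ}
    {y : Fin (d + 1) → EuclideanSpace ℝ (Fin n)} (hy : AffineIndependent ℝ y)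
    {f : EuclideanSpace ℝ (Fin n) → ℝ} (hf : ConvexOn ℝ (convexHull ℝ (Set.range y)) f) :
    AEStronglyMeasurable f ((volume.restrict (solidSimplex d)).map (simplexMap y)) := by
  rw [(measurableEmbedding_simplexMap hy).aestronglyMeasurable_map_iff]
  have hconv : ConvexOn ℝ (solidSimplex d) (f ∘ simplexMap y) := by
    refine ⟨convex_solidSimplex d, fun u hu v hv a b ha hb hab => ?_⟩
    have hmem {u} (hu : u ∈ solidSimplex d) :
        simplexMap y u ∈ convexHull ℝ (Set.range y) :=
      image_simplexMap_solidSimplex y ▸ Set.mem_image_of_mem _ hu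
    have hcomb : simplexMap y (a • u + b • v) = a • simplexMap y u + b • simplexMap y v := by
      simp only [simplexMap, map_add, map_smul, smul_add]
      rw [add_add_add_comm, ← add_smul, hab, one_smul]
    simpa only [Function.comp_apply, hcomb] using hf.2 (hmem hu) (hmem hv) ha hb hab
  have hnull : volume (frontier (solidSimplex d)) = 0 :=
    (convex_solidSimplex d).addHaar_frontier volume
  have hrest : volume.restrict (interior (solidSimplex d)) =
      volume.restrict (solidSimplex d) :=
    Measure.restrict_congr_set (interior_ae_eq_of_null_frontier hnull)
  rw [← hrest]
  exact hconv.continuousOn_interior.aestronglyMeasurable isOpen_interior.measurableSet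

theorem ae_pos_expMeasure_one : ∀ᵐ t ∂expMeasure 1, 0 < t := by
  have hρ : expMeasure 1 = volume.withDensity (exponentialPDF 1) := rfl
  rw [ae_iff]
  simp only [not_lt]
  change expMeasure 1 (Set.Iic 0) = 0
  rw [hρ, withDensity_apply _ measurableSet_Iic, setLIntegral_congr Iio_ae_eq_Iic.symm]
  refine (setLIntegral_congr_fun measurableSet_Iio fun t ht => ?_).trans lintegral_zero
  rw [exponentialPDF_one, if_neg (not_le.2 ht)]

theorem lintegral_ofReal_expMeasure_one : ∫⁻ t, ENNReal.ofReal t ∂expMeasure 1 = 1 := by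
  have hρ : expMeasure 1 = volume.withDensity (exponentialPDF 1) := rfl
  have hw := measurable_exponentialPDF 1
  rw [hρ, lintegral_withDensity_eq_lintegral_mul _ hw (by fun_prop),
    ← lintegral_gammaPDF_eq_one (a := 2) (r := 1) two_pos one_pos]
  refine lintegral_congr fun t => ?_
  rw [Pi.mul_apply, exponentialPDF_one, gammaPDF_eq]
  split_ifs with ht
  · rw [← ENNReal.ofReal_mul (Real.exp_pos _).le]
    congr 1
    norm_num [Real.Gamma_two]
    ring
  · simp

theorem ae_pos_pi_expMeasure_one (ι : Type*) [Fintype ι] :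
    ∀ᵐ t : ι → ℝ ∂Measure.pi (fun _ => expMeasure 1), ∀ i, 0 < t i := by
  have := isProbabilityMeasure_expMeasure one_pos
  exact Measure.ae_pi_le_pi (Filter.eventually_pi fun _ => ae_pos_expMeasure_one)

theorem lintegral_ofReal_sum_pi_expMeasure_one (ι : Type*) [Fintype ι] :
    ∫⁻ t : ι → ℝ, ENNReal.ofReal (∑ i, t i) ∂Measure.pi (fun _ => expMeasure 1) =
      Fintype.card ι := by
  have := isProbabilityMeasure_expMeasure one_pos
  have h : ∀ᵐ t : ι → ℝ ∂Measure.pi (fun _ => expMeasure 1),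
      ENNReal.ofReal (∑ i, t i) = ∑ i, ENNReal.ofReal (t i) := by
    filter_upwards [ae_pos_pi_expMeasure_one ι] with t ht
    exact ENNReal.ofReal_sum_of_nonneg fun i _ => (ht i).le
  rw [lintegral_congr_ae h, lintegral_finsetSum _ (by fun_prop)]
  have hi (i : ι) : ∫⁻ t : ι → ℝ, ENNReal.ofReal (t i) ∂Measure.pi (fun _ => expMeasure 1) = 1 :=
    ((measurePreserving_eval (fun _ => expMeasure 1) i).lintegral_comp
      ENNReal.measurable_ofReal).trans lintegral_ofReal_expMeasure_one
  simp [hi]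

/-- The normalized vector of exponential variables, weighted by the sum of the variables, maps to
a multiple of Hausdorff measure on a simplex. -/
theorem exists_map_withDensity_eq_smul_hausdorffMeasure {n d : ℕ}
    {y : Fin (d + 1) → EuclideanSpace ℝ (Fin n)} (hy : AffineIndependent ℝ y) :
    ∃ C : ENNReal, ∃ c : NNReal,
      (((Measure.pi fun _ : Fin (d + 1) => expMeasure 1).withDensity
        fun t => ENNReal.ofReal (∑ i, t i)).map
          fun t => simplexMap y fun i => t i.succ / ∑ j, t j) =
        C • (volume.restrict (solidSimplex d)).map (simplexMap y) ∧
      (volume.restrict (solidSimplex d)).map (simplexMap y) =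
        c • (μH[d] : Measure (EuclideanSpace ℝ (Fin n))).restrict
          (convexHull ℝ (Set.range y)) := by
  obtain ⟨C, hC⟩ := exists_lintegral_exp_eq_mul_setLIntegral_solidSimplex d
  obtain ⟨c, hc⟩ := exists_map_simplexMap_eq_smul_hausdorffMeasure hy
  refine ⟨C, c, ?_, hc⟩
  have hu : Measurable fun (t : Fin (d + 1) → ℝ) (i : Fin d) => t i.succ / ∑ j, t j := by
    fun_prop
  have hφ := (measurableEmbedding_simplexMap hy).measurable
  rw [← Measure.map_smul]
  refine (Measure.map_map hφ hu).symm.trans (congrArg _ ?_)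
  ext s hs
  have h1 : Measurable (s.indicator (1 : (Fin d → ℝ) → ENNReal)) := measurable_one.indicator hs
  have h := hC (s.indicator 1) h1
  rw [lintegral_indicator_one hs] at h
  rw [← lintegral_indicator_one hs, lintegral_map h1 hu,
    lintegral_withDensity_eq_lintegral_mul (g := fun t => s.indicator 1 fun i => _) _
      (by fun_prop) (h1.comp hu)]
  exact h

theorem integrable_and_integral_exp_eq_mul_avgH {n d : ℕ}
    {y : Fin (d + 1) → EuclideanSpace ℝ (Fin n)} (hy : AffineIndependent ℝ y)
    {f : EuclideanSpace ℝ (Fin n) → ℝ} (hf : ConvexOn ℝ (convexHull ℝ (Set.range y)) f)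
    {M : ℝ} (hM : ∀ z ∈ convexHull ℝ (Set.range y), |f z| ≤ M) :
    Integrable (fun t : Fin (d + 1) → ℝ =>
        (∑ i, t i) * f (simplexMap y fun i => t i.succ / ∑ j, t j))
      (Measure.pi fun _ => expMeasure 1) ∧
    ∫ t : Fin (d + 1) → ℝ, (∑ i, t i) * f (simplexMap y fun i => t i.succ / ∑ j, t j)
      ∂(Measure.pi fun _ => expMeasure 1) =
      ((d : ℝ) + 1) * avgH f d (convexHull ℝ (Set.range y)) := by
  obtain ⟨C, c, hmap, hc⟩ := exists_map_withDensity_eq_smul_hausdorffMeasure hy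
  set P : Measure (Fin (d + 1) → ℝ) := Measure.pi fun _ => expMeasure 1
  set s : (Fin (d + 1) → ℝ) → ENNReal := fun t => ENNReal.ofReal (∑ i, t i) with hs
  set g : (Fin (d + 1) → ℝ) → EuclideanSpace ℝ (Fin n) :=
    fun t => simplexMap y fun i => t i.succ / ∑ j, t j
  set m := (μH[d] : Measure (EuclideanSpace ℝ (Fin n))).restrict (convexHull ℝ (Set.range y))
    with hm
  have hsm : Measurable s := by fun_prop
  have hgm : Measurable g := (measurableEmbedding_simplexMap hy).measurable.comp (by fun_prop)
  have hmeas : AEStronglyMeasurable f ((P.withDensity s).map g) := by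
    rw [hmap]
    exact (aestronglyMeasurable_of_convexOn hy hf).smul_measure C
  have hmapm : (P.withDensity s).map g = (C * c) • m := by
    rw [hmap, hc, mul_smul]; rfl
  have hmass : (P.withDensity s).map g Set.univ = d + 1 := by
    rw [Measure.map_apply hgm MeasurableSet.univ, Set.preimage_univ,
      withDensity_apply _ MeasurableSet.univ, Measure.restrict_univ,
      lintegral_ofReal_sum_pi_expMeasure_one]
    simp
  have hfin : IsFiniteMeasure ((P.withDensity s).map g) := by
    constructor
    rw [hmass]
    exact ENNReal.add_lt_top.2 ⟨ENNReal.natCast_lt_top d, ENNReal.one_lt_top⟩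
  have hint : Integrable f ((P.withDensity s).map g) := by
    refine Integrable.of_bound hmeas M ?_
    rw [hmapm]
    refine Measure.ae_smul_measure ?_ _
    filter_upwards [ae_restrict_mem
      ((Set.finite_range y).isClosed_convexHull ℝ).measurableSet] with z hz using hM z hz
  have hprod : ∀ᵐ t ∂P, (s t).toReal • f (g t) = (∑ i, t i) * f (g t) := by
    filter_upwards [ae_pos_pi_expMeasure_one (Fin (d + 1))] with t ht
    rw [hs, smul_eq_mul, ENNReal.toReal_ofReal (Finset.sum_nonneg fun i _ => (ht i).le)]
  have hfins : ∀ᵐ t ∂P, s t < ⊤ := Filter.Eventually.of_forall fun t => ENNReal.ofReal_lt_top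
  constructor
  · have h := (integrable_map_measure hmeas hgm.aemeasurable).1 hint
    rw [integrable_withDensity_iff_integrable_smul' hsm hfins] at h
    exact h.congr hprod
  · rw [← integral_congr_ae hprod, ← integral_withDensity_eq_integral_toReal_smul hsm hfins
      (fun t => f (g t)), ← integral_map hgm.aemeasurable hmeas, hmapm, integral_smul_measure,
      avgH, average_eq]
    rw [hmapm, Measure.smul_apply, smul_eq_mul] at hmass
    have hreal : (C * c).toReal * m.real Set.univ = d + 1 := by
      rw [measureReal_def, ← ENNReal.toReal_mul, hmass]
      simpa using ENNReal.toReal_natCast (d + 1)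
    have hne : m.real Set.univ ≠ 0 := by
      intro h0
      rw [h0, mul_zero] at hreal
      exact (Nat.cast_add_one_ne_zero d) hreal.symm
    rw [← hm, ← hreal, smul_eq_mul, smul_eq_mul]
    field_simp

theorem map_comp_pi_expMeasure_one {ι κ : Type*} [Fintype ι] [Fintype κ] {e : κ → ι}
    (he : Function.Injective e) :
    (Measure.pi fun _ : ι => expMeasure 1).map (fun t i => t (e i)) =
      Measure.pi fun _ : κ => expMeasure 1 := by
  have := isProbabilityMeasure_expMeasure one_pos
  have hind : iIndepFun (fun (i : ι) (t : ι → ℝ) => t i) (Measure.pi fun _ => expMeasure 1) :=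
    iIndepFun_pi (X := fun _ t => t) fun _ => aemeasurable_id
  rw [(iIndepFun_iff_map_fun_eq_pi_map fun i => (measurable_pi_apply (e i)).aemeasurable).1
    (hind.precomp he)]
  congr 1
  ext1 i
  exact (measurePreserving_eval (fun _ => expMeasure 1) (e i)).map_eq

theorem ConvexOn.exists_abs_le_of_convexHull_range {ι E : Type*} [Fintype ι] [Nonempty ι]
    [AddCommGroup E] [Module ℝ E] {x : ι → E} {f : E → ℝ}
    (hf : ConvexOn ℝ (convexHull ℝ (Set.range x)) f) :
    ∃ M, ∀ z ∈ convexHull ℝ (Set.range x), |f z| ≤ M := by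
  have hxm (i : ι) : x i ∈ convexHull ℝ (Set.range x) :=
    subset_convexHull ℝ _ (Set.mem_range_self i)
  set m : ℝ := (Fintype.card ι : ℝ) with hm
  have hmpos : 0 < m := by simp [hm, Fintype.card_pos]
  set b : E := m⁻¹ • ∑ i, x i with hb
  set B : ℝ := ∑ i, |f (x i)| with hB
  have hB0 : 0 ≤ B := Finset.sum_nonneg fun i _ => abs_nonneg _
  refine ⟨m * |f b| + B, fun z hz => ?_⟩
  have hz' := hz
  rw [convexHull_range_eq_image_stdSimplex] at hz'
  obtain ⟨w, ⟨hw, hw1⟩, hwz⟩ := hz'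
  rw [Fintype.linearCombination_apply] at hwz
  have hw_le (i : ι) : w i ≤ 1 :=
    hw1 ▸ Finset.single_le_sum (fun j _ => hw j) (Finset.mem_univ i)
  have hupper : f z ≤ B := by
    rw [← hwz]
    refine (hf.map_sum_le (fun i _ => hw i) hw1 fun i _ => hxm i).trans ?_
    refine Finset.sum_le_sum fun i _ => ?_
    rw [smul_eq_mul]
    nlinarith [hw i, hw_le i, le_abs_self (f (x i)), abs_nonneg (f (x i))]
  have hlower : f b ≤ m⁻¹ * f z + ∑ i, m⁻¹ * (1 - w i) * f (x i) := by
    have h := hf.map_sum_le (t := Finset.univ)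
      (w := fun o : Option ι => o.elim m⁻¹ fun i => m⁻¹ * (1 - w i))
      (p := fun o : Option ι => o.elim z x) ?_ ?_ ?_
    · simp only [Fintype.sum_option, Option.elim_none, Option.elim_some, smul_eq_mul] at h
      have hcomb : m⁻¹ • z + ∑ i, (m⁻¹ * (1 - w i)) • x i = b := by
        rw [hb, ← hwz]
        simp only [mul_smul, ← Finset.smul_sum, sub_smul, one_smul, Finset.sum_sub_distrib]
        rw [← smul_add, add_sub_cancel]
      rwa [hcomb] at h
    · rintro (_ | i) _
      · exact (inv_pos.2 hmpos).le
      · exact mul_nonneg (inv_pos.2 hmpos).le (sub_nonneg.2 (hw_le i))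
    · simp only [Fintype.sum_option, Option.elim_none, Option.elim_some, ← Finset.mul_sum,
        Finset.sum_sub_distrib, hw1, Finset.sum_const, Finset.card_univ, nsmul_eq_mul, mul_one,
        ← hm]
      field_simp
      ring
    · rintro (_ | i) _
      · exact hz
      · exact hxm i
  have hrest : ∑ i, m⁻¹ * (1 - w i) * f (x i) ≤ m⁻¹ * B := by
    rw [hB, Finset.mul_sum]
    refine Finset.sum_le_sum fun i _ => ?_
    rw [mul_assoc]
    refine mul_le_mul_of_nonneg_left ?_ (inv_pos.2 hmpos).le
    nlinarith [hw i, hw_le i, le_abs_self (f (x i)), abs_nonneg (f (x i))]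
  have hmul : m * f b ≤ f z + B := by
    have h := mul_le_mul_of_nonneg_left (hlower.trans (add_le_add_right hrest _)) hmpos.le
    rwa [← mul_add, mul_inv_cancel_left₀ hmpos.ne'] at h
  rw [abs_le]
  constructor
  · nlinarith [neg_abs_le (f b)]
  · nlinarith [abs_nonneg (f b)]

theorem simplexMap_div_sum_eq_centerMass {n d : ℕ} (y : Fin (d + 1) → EuclideanSpace ℝ (Fin n))
    {t : Fin (d + 1) → ℝ} (ht : ∑ i, t i ≠ 0) :
    simplexMap y (fun i => t i.succ / ∑ j, t j) = Finset.univ.centerMass t y := by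
  have h0 : 1 - ∑ i : Fin d, t i.succ / ∑ j, t j = (∑ j, t j)⁻¹ * t 0 := by
    rw [← Finset.sum_div, inv_mul_eq_div, eq_div_iff ht, sub_mul, div_mul_cancel₀ _ ht,
      Fin.sum_univ_succ]
    ring
  rw [simplexMap_eq_sum, h0, Finset.centerMass, Fin.sum_univ_succ (fun i => t i • y i), smul_add,
    Finset.smul_sum]
  simp only [smul_smul, div_eq_inv_mul]

/-- The average of a convex function over a face, scaled by the number of vertices of the face, is
an expectation over independent exponential variables attached to the vertices. -/
theorem integrable_and_integral_centerMass_eq_card_mul_avgH {n m : ℕ}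
    {x : Fin m → EuclideanSpace ℝ (Fin n)} (hx : AffineIndependent ℝ x)
    {f : EuclideanSpace ℝ (Fin n) → ℝ} {K : Finset (Fin m)} (hK : K.Nonempty)
    (hf : ConvexOn ℝ (convexHull ℝ (x '' ↑K)) f)
    {M : ℝ} (hM : ∀ z ∈ convexHull ℝ (x '' ↑K), |f z| ≤ M) :
    Integrable (fun t : Fin m → ℝ => (∑ i ∈ K, t i) * f (K.centerMass t x))
      (Measure.pi fun _ => expMeasure 1) ∧
    ∫ t : Fin m → ℝ, (∑ i ∈ K, t i) * f (K.centerMass t x)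
      ∂(Measure.pi fun _ => expMeasure 1) =
      (K.card : ℝ) * avgH f ((K.card : ℝ) - 1) (convexHull ℝ (x '' ↑K)) := by
  obtain ⟨d, hd⟩ : ∃ d, K.card = d + 1 := Nat.exists_eq_add_one.2 hK.card_pos
  let e : Fin (d + 1) ↪o Fin m := K.orderEmbOfFin hd
  have hmapK : Finset.univ.map e.toEmbedding = K := by
    apply Finset.coe_injective
    rw [Finset.coe_map, Finset.coe_univ, Set.image_univ]
    exact K.range_orderEmbOfFin hd
  have hrange : Set.range (x ∘ e) = x '' ↑K := by
    rw [Set.range_comp, K.range_orderEmbOfFin hd]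
  have hy : AffineIndependent ℝ (x ∘ e) := hx.comp_embedding e.toEmbedding
  rw [← hrange] at hf hM ⊢
  obtain ⟨hint, hval⟩ := integrable_and_integral_exp_eq_mul_avgH hy hf hM
  have hpt (t : Fin m → ℝ) : (∑ i ∈ K, t i) * f (K.centerMass t x) =
      (∑ j, t (e j)) * f (simplexMap (x ∘ e) fun i => t (e i.succ) / ∑ j, t (e j)) := by
    have hsum : ∑ i ∈ K, t i = ∑ j, t (e j) := by
      conv_lhs => rw [← hmapK, Finset.sum_map]
      rfl
    have hsum' : ∑ i ∈ K, t i • x i = ∑ j, t (e j) • x (e j) := by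
      conv_lhs => rw [← hmapK, Finset.sum_map]
      rfl
    rw [hsum]
    by_cases h0 : ∑ j, t (e j) = 0
    · rw [h0, zero_mul, zero_mul]
    · rw [simplexMap_div_sum_eq_centerMass (x ∘ e) (t := fun j => t (e j)) h0,
        Finset.centerMass, Finset.centerMass, hsum, hsum']
      rfl
  have hre : Measurable fun (t : Fin m → ℝ) (j : Fin (d + 1)) => t (e j) := by fun_prop
  rw [← map_comp_pi_expMeasure_one e.injective] at hint hval
  simp_rw [hpt]
  refine ⟨(integrable_map_measure hint.aestronglyMeasurable hre.aemeasurable).1 hint, ?_⟩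
  rw [integral_map hre.aemeasurable hint.aestronglyMeasurable] at hval
  rw [hval, hd]
  push_cast
  rw [add_sub_cancel_right]

theorem sum_mul_map_centerMass_le_of_biUnion {ι E : Type*} [DecidableEq ι] [AddCommGroup E]
    [Module ℝ E] {x : ι → E} {f : E → ℝ} (hf : ConvexOn ℝ (convexHull ℝ (Set.range x)) f)
    {t : ι → ℝ} (ht : ∀ i, 0 < t i) {P : Finset (Finset ι)} (hP : P.Nonempty)
    (hne : ∀ L ∈ P, L.Nonempty) (hdisj : (P : Set (Finset ι)).PairwiseDisjoint id) :
    (∑ i ∈ P.biUnion id, t i) * f ((P.biUnion id).centerMass t x) ≤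
      ∑ L ∈ P, (∑ i ∈ L, t i) * f (L.centerMass t x) := by
  have hpos (L) (hL : L ∈ P) : 0 < ∑ i ∈ L, t i := Finset.sum_pos (fun i _ => ht i) (hne L hL)
  have hsum : ∑ i ∈ P.biUnion id, t i = ∑ L ∈ P, ∑ i ∈ L, t i := Finset.sum_biUnion hdisj
  have hsum' : ∑ i ∈ P.biUnion id, t i • x i = ∑ L ∈ P, (∑ i ∈ L, t i) • L.centerMass t x := by
    rw [Finset.sum_biUnion hdisj]
    refine Finset.sum_congr rfl fun L hL => ?_
    rw [Finset.centerMass, smul_inv_smul₀ (hpos L hL).ne']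
    rfl
  have htot : 0 < ∑ L ∈ P, ∑ i ∈ L, t i := Finset.sum_pos hpos hP
  have hcm : (P.biUnion id).centerMass t x =
      P.centerMass (fun L => ∑ i ∈ L, t i) fun L => L.centerMass t x := by
    rw [Finset.centerMass, Finset.centerMass, hsum, hsum']
  have h := hf.map_centerMass_le (fun L hL => (hpos L hL).le) htot
    (fun L hL => L.centerMass_mem_convexHull (fun i _ => (ht i).le) (hpos L hL)
      fun i _ => Set.mem_range_self i)
  rw [hcm, hsum]
  rw [Finset.centerMass.eq_def P _ (f ∘ _), smul_eq_mul, inv_mul_eq_div, le_div_iff₀ htot] at h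
  rw [mul_comm]
  simpa using h

theorem biUnion_filter_subset_of_isPartition {m : ℕ} {𝒦 𝒧 : Finset (Finset (Fin m))}
    (h𝒦 : IsPartition 𝒦) (h𝒧 : IsPartition 𝒧) (href : ∀ L ∈ 𝒧, ∃ K ∈ 𝒦, L ⊆ K)
    {K : Finset (Fin m)} (hK : K ∈ 𝒦) : (𝒧.filter (· ⊆ K)).biUnion id = K := by
  ext i
  simp only [Finset.mem_biUnion, Finset.mem_filter, id]
  constructor
  · rintro ⟨L, ⟨-, hLK⟩, hi⟩
    exact hLK hi
  · intro hi
    have hmem : i ∈ 𝒧.sup id := h𝒧.2.2 ▸ Finset.mem_univ i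
    obtain ⟨L, hL, hiL⟩ := Finset.mem_sup.1 hmem
    obtain ⟨K', hK', hLK'⟩ := href L hL
    have hKK' : K' = K := h𝒦.2.1.elim_finset hK' hK i (hLK' hiL) hi
    exact ⟨L, ⟨hL, hKK' ▸ hLK'⟩, hiL⟩

theorem sum_sum_filter_subset_of_isPartition {m : ℕ} {𝒦 𝒧 : Finset (Finset (Fin m))}
    (h𝒦 : IsPartition 𝒦) (h𝒧 : IsPartition 𝒧) (href : ∀ L ∈ 𝒧, ∃ K ∈ 𝒦, L ⊆ K)
    (G : Finset (Fin m) → ℝ) :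
    ∑ K ∈ 𝒦, ∑ L ∈ 𝒧.filter (· ⊆ K), G L = ∑ L ∈ 𝒧, G L := by
  simp_rw [Finset.sum_filter]
  rw [Finset.sum_comm]
  refine Finset.sum_congr rfl fun L hL => ?_
  obtain ⟨K, hK, hLK⟩ := href L hL
  rw [Finset.sum_eq_single K, if_pos hLK]
  · intro K' hK' hne
    refine if_neg fun hLK' => hne ?_
    obtain ⟨i, hi⟩ := h𝒧.1 L hL
    exact h𝒦.2.1.elim_finset hK' hK i (hLK' hi) (hLK hi)
  · exact fun h => absurd hK h

theorem F_le_of_refines (n : ℕ) (x : Fin (n + 1) → EuclideanSpace ℝ (Fin n))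
    (hx : AffineIndependent ℝ x) (f : EuclideanSpace ℝ (Fin n) → ℝ)
    (hf : ConvexOn ℝ (convexHull ℝ (Set.range x)) f)
    (𝒦 𝒧 : Finset (Finset (Fin (n + 1)))) (h𝒦 : IsPartition 𝒦) (h𝒧 : IsPartition 𝒧)
    (href : ∀ L ∈ 𝒧, ∃ K ∈ 𝒦, L ⊆ K) :
    (∑ K ∈ 𝒦, (K.card : ℝ) * avgH f ((K.card : ℝ) - 1) (convexHull ℝ (x '' ↑K))) ≤
      ∑ L ∈ 𝒧, (L.card : ℝ) * avgH f ((L.card : ℝ) - 1) (convexHull ℝ (x '' ↑L)) := by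
  obtain ⟨M, hM⟩ := hf.exists_abs_le_of_convexHull_range
  have hsub (K : Finset (Fin (n + 1))) :
      convexHull ℝ (x '' ↑K) ⊆ convexHull ℝ (Set.range x) :=
    convexHull_mono (Set.image_subset_range _ _)
  have hface (K : Finset (Fin (n + 1))) (hK : K.Nonempty) :=
    integrable_and_integral_centerMass_eq_card_mul_avgH hx hK
      (hf.subset (hsub K) (convex_convexHull ℝ _)) fun z hz => hM z (hsub K hz)
  rw [← Finset.sum_congr rfl fun K hK => (hface K (h𝒦.1 K hK)).2,
    ← Finset.sum_congr rfl fun L hL => (hface L (h𝒧.1 L hL)).2,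
    ← integral_finsetSum _ fun K hK => (hface K (h𝒦.1 K hK)).1,
    ← integral_finsetSum _ fun L hL => (hface L (h𝒧.1 L hL)).1]
  refine integral_mono_ae (integrable_finsetSum _ fun K hK => (hface K (h𝒦.1 K hK)).1)
    (integrable_finsetSum _ fun L hL => (hface L (h𝒧.1 L hL)).1) ?_
  filter_upwards [ae_pos_pi_expMeasure_one (Fin (n + 1))] with t ht
  rw [← sum_sum_filter_subset_of_isPartition h𝒦 h𝒧 href]
  refine Finset.sum_le_sum fun K hK => ?_
  have hun := biUnion_filter_subset_of_isPartition h𝒦 h𝒧 href hK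
  have hne : (𝒧.filter (· ⊆ K)).Nonempty := by
    rw [Finset.nonempty_iff_ne_empty]
    intro h
    rw [h, Finset.biUnion_empty] at hun
    exact (h𝒦.1 K hK).ne_empty hun.symm
  have h := sum_mul_map_centerMass_le_of_biUnion hf ht hne
    (fun L hL => h𝒧.1 L (Finset.mem_filter.1 hL).1)
    (h𝒧.2.1.subset (Finset.coe_subset.2 (Finset.filter_subset _ _)))
  rwa [hun] at h
end

section
/- Let Δ ⊂ ℝⁿ be a nondegenerate simplex with barycenter b, and for each i ∈ N = {0,…,n} let K_i = N \ {i}. If f : Δ → ℝ is convex, then Avg(f, Δ) ≤ (1/(n+1))·f(b) + (n/(n+1))·(1/(n+1))·Σ_{i=0}^{n} Avg(f, Δ_{K_i}). -/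
open MeasureTheory

section SimplexAverage

open Set Module
open scoped Pointwise

theorem bddBelow_image_of_convexOn {E : Type*} [NormedAddCommGroup E] [NormedSpace ℝ E]
    {K : Set E} (hK : Bornology.IsBounded K) (hint : (interior K).Nonempty)
    {f : E → ℝ} (hf : ConvexOn ℝ K f) (hb : BddAbove (f '' K)) : BddBelow (f '' K) := by
  obtain ⟨c, hc⟩ := hint
  obtain ⟨r, hr, hball⟩ := Metric.mem_nhds_iff.1 (mem_interior_iff_mem_nhds.1 hc)
  obtain ⟨M, hM⟩ := hb
  obtain ⟨R, hR, hKR⟩ := hK.subset_closedBall_lt 0 c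
  set ε : ℝ := r / (2 * R) with hε
  have hε0 : 0 < ε := by positivity
  refine ⟨((1 + ε) * f c - M) / ε, ?_⟩
  rintro _ ⟨y, hy, rfl⟩
  have hzK : c - ε • (y - c) ∈ K := by
    apply hball
    rw [Metric.mem_ball, dist_eq_norm, sub_sub_cancel_left, norm_neg, norm_smul,
      Real.norm_of_nonneg hε0.le, ← dist_eq_norm]
    have : dist y c ≤ R := hKR hy
    calc ε * dist y c ≤ ε * R := by gcongr
      _ = r / 2 := by rw [hε]; field_simp
      _ < r := by linarith
  have hz := hM ⟨_, hzK, rfl⟩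
  have hcomb := hf.2 hzK hy (show 0 ≤ 1 / (1 + ε) by positivity)
    (show 0 ≤ ε / (1 + ε) by positivity) (by field_simp)
  have hc' : (1 / (1 + ε)) • (c - ε • (y - c)) + (ε / (1 + ε)) • y = c := by
    match_scalars <;> field_simp <;> ring
  rw [hc', smul_eq_mul, smul_eq_mul] at hcomb
  rw [div_le_iff₀ hε0]
  have h1 : (1 + ε) * f c ≤ f (c - ε • (y - c)) + ε * f y := by
    calc _ ≤ (1 + ε) * _ := mul_le_mul_of_nonneg_left hcomb (by positivity)
      _ = _ := by field_simp
  linarith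

theorem ConvexOn.integrableOn_of_isCompact {E : Type*} [NormedAddCommGroup E] [NormedSpace ℝ E]
    [FiniteDimensional ℝ E] [MeasurableSpace E] [BorelSpace E] (μ : Measure E)
    [μ.IsAddHaarMeasure] {K : Set E} (hK : IsCompact K) {f : E → ℝ} (hf : ConvexOn ℝ K f)
    (hb : BddAbove (f '' K)) : IntegrableOn f K μ := by
  have hae : interior K =ᵐ[μ] K := interior_ae_eq_of_null_frontier (hf.1.addHaar_frontier μ)
  rw [← integrableOn_congr_set_ae hae]
  rcases (interior K).eq_empty_or_nonempty with h | h
  · simp [h]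
  obtain ⟨m, hm⟩ := bddBelow_image_of_convexOn hK.isBounded h hf hb
  obtain ⟨M, hM⟩ := hb
  refine IntegrableOn.of_bound (C := max |m| |M|)
    ((measure_mono interior_subset).trans_lt hK.measure_lt_top) ?_ ?_
  · exact (hf.continuousOn_interior).aestronglyMeasurable isOpen_interior.measurableSet
  · refine (ae_restrict_iff' isOpen_interior.measurableSet).2 (.of_forall fun y hy => ?_)
    have h1 := hm ⟨y, interior_subset hy, rfl⟩
    have h2 := hM ⟨y, interior_subset hy, rfl⟩
    rw [Real.norm_eq_abs]
    exact abs_le_max_abs_abs h1 h2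

/-- An affine equivalence carries Haar measure to Haar measure, up to a scalar. -/
theorem exists_map_affineEquiv_eq_smul {E F : Type*} [NormedAddCommGroup E] [NormedSpace ℝ E]
    [FiniteDimensional ℝ E] [MeasurableSpace E] [BorelSpace E]
    [NormedAddCommGroup F] [NormedSpace ℝ F]
    [FiniteDimensional ℝ F] [MeasurableSpace F] [BorelSpace F]
    (μ : Measure E) [μ.IsAddHaarMeasure] (ν : Measure F) [ν.IsAddHaarMeasure]
    (A : E ≃ᵃ[ℝ] F) : ∃ c : NNReal, ν = c • μ.map A := by
  have hA : (A : E → F) = (fun y => y + A 0) ∘ A.linear.toContinuousLinearEquiv := by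
    ext y
    have := A.map_vadd 0 y
    simpa using this
  have : (μ.map A).IsAddHaarMeasure := by
    rw [hA, ← Measure.map_map (by fun_prop) (by fun_prop), map_add_right_eq_self]
    infer_instance
  exact ⟨_, Measure.isAddLeftInvariant_eq_smul _ _⟩

/-- The cone with apex `0` over `{1} × S`. -/
def coneOver {E : Type*} [AddCommGroup E] [Module ℝ E] (S : Set E) : Set (ℝ × E) :=
  (fun p : ℝ × E => (p.1, p.1 • p.2)) '' (Icc 0 1 ×ˢ S)

theorem isCompact_coneOver {E : Type*} [NormedAddCommGroup E] [NormedSpace ℝ E] {S : Set E}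
    (hS : IsCompact S) : IsCompact (coneOver S) :=
  (isCompact_Icc.prod hS).image (by fun_prop)

/-- Integration over a cone, slice by slice. -/
theorem setIntegral_coneOver {E : Type*} [NormedAddCommGroup E] [NormedSpace ℝ E]
    [FiniteDimensional ℝ E] [MeasurableSpace E] [BorelSpace E] (ν : Measure E)
    [ν.IsAddHaarMeasure] {S : Set E} (hS : IsCompact S) {g : ℝ × E → ℝ}
    (hg : IntegrableOn g (coneOver S) (volume.prod ν)) :
    IntegrableOn (fun t : ℝ => t ^ finrank ℝ E * ∫ u in S, g (t, t • u) ∂ν) (Ioc 0 1) ∧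
    ∫ z in coneOver S, g z ∂(volume.prod ν) =
      ∫ t in Ioc (0 : ℝ) 1, t ^ finrank ℝ E * ∫ u in S, g (t, t • u) ∂ν := by
  have hC := (isCompact_coneOver hS).measurableSet
  rw [← integrable_indicator_iff hC] at hg
  have hinner : ∀ t ∈ Ioc (0 : ℝ) 1, ∫ w, (coneOver S).indicator g (t, w) ∂ν =
      t ^ finrank ℝ E * ∫ u in S, g (t, t • u) ∂ν := by
    intro t ht
    have hpre : ∀ w, (t, w) ∈ coneOver S ↔ w ∈ t • S := by
      intro w
      simp only [coneOver, mem_image, mem_prod, Prod.mk.injEq, Prod.exists, mem_smul_set]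
      constructor
      · rintro ⟨_, u, ⟨_, hu⟩, rfl, rfl⟩
        exact ⟨u, hu, rfl⟩
      · rintro ⟨u, hu, rfl⟩
        exact ⟨t, u, ⟨⟨ht.1.le, ht.2⟩, hu⟩, rfl, rfl⟩
    have h1 : ∀ w, (coneOver S).indicator g (t, w) = (t • S).indicator (fun w => g (t, w)) w := by
      intro w
      by_cases h : w ∈ t • S
      · rw [indicator_of_mem h, indicator_of_mem ((hpre w).2 h)]
      · rw [indicator_of_notMem h, indicator_of_notMem (mt (hpre w).1 h)]
    simp_rw [h1]
    rw [integral_indicator (hS.smul t).measurableSet,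
      Measure.setIntegral_comp_smul_of_pos ν (fun w => g (t, w)) S ht.1, smul_eq_mul,
      mul_inv_cancel_left₀ (pow_pos ht.1 _).ne']
  have houter : (fun t => ∫ w, (coneOver S).indicator g (t, w) ∂ν) =ᵐ[volume]
      (Ioc (0 : ℝ) 1).indicator fun t => t ^ finrank ℝ E * ∫ u in S, g (t, t • u) ∂ν := by
    have h0 : ∀ᵐ t : ℝ, t ≠ 0 := by simp [ae_iff]
    filter_upwards [h0] with t ht0
    by_cases ht : t ∈ Ioc (0 : ℝ) 1
    · rw [indicator_of_mem ht, hinner t ht]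
    · rw [indicator_of_notMem ht]
      have : ∀ w, (coneOver S).indicator g (t, w) = 0 := fun w => by
        refine indicator_of_notMem ?_ _
        rintro ⟨⟨s, u⟩, ⟨hs, -⟩, h⟩
        obtain rfl : s = t := congrArg Prod.fst h
        exact ht ⟨lt_of_le_of_ne hs.1 ht0.symm, hs.2⟩
      simp [this]
  constructor
  · rw [← integrable_indicator_iff measurableSet_Ioc]
    exact hg.integral_prod_left.congr houter
  · rw [← integral_indicator hC, integral_prod _ hg, integral_congr_ae houter,
      integral_indicator measurableSet_Ioc]

theorem measureReal_coneOver {E : Type*} [NormedAddCommGroup E] [NormedSpace ℝ E]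
    [FiniteDimensional ℝ E] [MeasurableSpace E] [BorelSpace E] (ν : Measure E)
    [ν.IsAddHaarMeasure] {S : Set E} (hS : IsCompact S) :
    ((volume : Measure ℝ).prod ν).real (coneOver S) = ν.real S / (finrank ℝ E + 1) := by
  have h := (setIntegral_coneOver ν hS (g := fun _ => 1)
    (integrableOn_const (isCompact_coneOver hS).measure_lt_top.ne)).2
  rw [setIntegral_const, smul_eq_mul, mul_one] at h
  rw [h]
  simp only [setIntegral_const, smul_eq_mul, mul_one]
  rw [integral_mul_const, ← intervalIntegral.integral_of_le zero_le_one, integral_pow]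
  simp
  ring

theorem setIntegral_coneOver_le {E : Type*} [NormedAddCommGroup E] [NormedSpace ℝ E]
    [FiniteDimensional ℝ E] [MeasurableSpace E] [BorelSpace E] (ν : Measure E)
    [ν.IsAddHaarMeasure] {S : Set E} (hS : IsCompact S) (hSc : Convex ℝ S) {g : ℝ × E → ℝ}
    {K : Set (ℝ × E)} (hgK : ConvexOn ℝ K g) (hb : BddAbove (g '' K)) (h0 : 0 ∈ K)
    (h1 : ∀ u ∈ S, ((1 : ℝ), u) ∈ K)
    (hg : IntegrableOn g (coneOver S) (volume.prod ν)) :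
    ∫ z in coneOver S, g z ∂(volume.prod ν) ≤ ((volume : Measure ℝ).prod ν).real (coneOver S) *
      (1 / (finrank ℝ E + 2) * g 0 +
        (finrank ℝ E + 1) / (finrank ℝ E + 2) * ⨍ u in S, g (1, u) ∂ν) := by
  set d := finrank ℝ E
  have hcomb : ∀ t ∈ Icc (0 : ℝ) 1, ∀ u : E,
      (1 - t) • (0 : ℝ × E) + t • ((1 : ℝ), u) = (t, t • u) := by
    intro t _ u; simp
  have hmem : ∀ t ∈ Icc (0 : ℝ) 1, ∀ u ∈ S, (t, t • u) ∈ K := fun t ht u hu => by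
    rw [← hcomb t ht u]
    exact hgK.1 h0 (h1 u hu) (by linarith [ht.2]) ht.1 (by ring)
  have hint : ∀ t ∈ Icc (0 : ℝ) 1, IntegrableOn (fun u => g (t, t • u)) S ν := by
    intro t ht
    refine ConvexOn.integrableOn_of_isCompact ν hS ⟨hSc, fun u hu v hv a b ha hb' hab => ?_⟩ ?_
    · have := hgK.2 (hmem t ht u hu) (hmem t ht v hv) ha hb' hab
      convert this using 2
      ext
      · simp [← add_mul, hab]
      · simp [smul_comm t]
    · refine hb.mono ?_
      rintro _ ⟨u, hu, rfl⟩
      exact ⟨_, hmem t ht u hu, rfl⟩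
  have hint1 : IntegrableOn (fun u => g (1, u)) S ν := by
    simpa using hint 1 ⟨zero_le_one, le_rfl⟩
  obtain ⟨hI, heq⟩ := setIntegral_coneOver ν hS hg
  have havg : ∫ u in S, g (1, u) ∂ν = ν.real S * ⨍ u in S, g (1, u) ∂ν := by
    rw [← smul_eq_mul, measure_smul_setAverage _ hS.measure_lt_top.ne]
  have hle : ∫ t in Ioc (0 : ℝ) 1, t ^ d * ∫ u in S, g (t, t • u) ∂ν ≤
      ∫ t in Ioc (0 : ℝ) 1, (t ^ d * (ν.real S * g 0) +
        t ^ (d + 1) * (∫ u in S, g (1, u) ∂ν - ν.real S * g 0)) := by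
    refine setIntegral_mono_on hI ?_ measurableSet_Ioc fun t ht => ?_
    · refine (Continuous.integrableOn_Icc ?_).mono_set Ioc_subset_Icc_self
      fun_prop
    have ht' := Ioc_subset_Icc_self ht
    have hconst : Integrable (fun _ : E => (1 - t) * g 0) (ν.restrict S) :=
      integrableOn_const hS.measure_lt_top.ne
    have : ∫ u in S, g (t, t • u) ∂ν ≤ ∫ u in S, ((1 - t) * g 0 + t * g (1, u)) ∂ν := by
      refine setIntegral_mono_on (hint t ht') ?_ hS.measurableSet fun u hu => ?_
      · exact hconst.add (hint1.const_mul t)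
      · have := hgK.2 h0 (h1 u hu) (show 0 ≤ 1 - t by linarith [ht.2]) ht'.1 (by ring)
        rwa [hcomb t ht' u] at this
    rw [integral_add hconst (hint1.const_mul t), setIntegral_const, integral_const_mul,
      smul_eq_mul] at this
    calc _ ≤ t ^ d * _ := mul_le_mul_of_nonneg_left this (pow_nonneg ht'.1 _)
      _ = _ := by ring
  rw [heq]
  refine hle.trans_eq ?_
  rw [measureReal_coneOver ν hS, ← intervalIntegral.integral_of_le zero_le_one,
    intervalIntegral.integral_add (Continuous.intervalIntegrable (by fun_prop) _ _)
      (Continuous.intervalIntegrable (by fun_prop) _ _),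
    intervalIntegral.integral_mul_const, intervalIntegral.integral_mul_const, integral_pow,
    integral_pow, havg]
  have : (finrank ℝ E : ℝ) = d := rfl
  rw [this]
  simp
  field_simp
  ring

theorem setAverage_preimage_isometry {X Y : Type*} [MetricSpace X] [CompleteSpace X]
    [MeasurableSpace X] [BorelSpace X] [MetricSpace Y] [MeasurableSpace Y]
    [BorelSpace Y] {i : X → Y} (hi : Isometry i) {d : ℝ} (hd : 0 ≤ d) {F : Set Y}
    (hF : MeasurableSet F) (hFi : F ⊆ range i) (f : Y → ℝ) :
    ⨍ y in F, f y ∂μH[d] = ⨍ u in i ⁻¹' F, f (i u) ∂μH[d] := by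
  have hme : MeasurableEmbedding i := hi.isClosedEmbedding.measurableEmbedding
  have hmap : (μH[d] : Measure Y).restrict F =
      ((μH[d] : Measure X).map i).restrict F := by
    rw [hi.map_hausdorffMeasure (.inl hd), Measure.restrict_restrict hF,
      inter_eq_left.2 hFi]
  rw [setAverage_eq, setAverage_eq, hmap, hme.setIntegral_map]
  congr 2
  have := congrArg (fun m : Measure Y => m univ) hmap
  simp only [Measure.restrict_apply_univ] at this
  rw [measureReal_def, this, hme.map_apply, measureReal_def]

/-- The cone with apex `b` and base `F`, as the union of the segments joining `b` to `F`. -/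
def coneFrom {E : Type*} [AddCommGroup E] [Module ℝ E] (b : E) (F : Set E) : Set E :=
  (fun q : ℝ × E => b + q.1 • (q.2 - b)) '' (Icc 0 1 ×ˢ F)

theorem isCompact_coneFrom {E : Type*} [NormedAddCommGroup E] [NormedSpace ℝ E] (b : E)
    {F : Set E} (hF : IsCompact F) : IsCompact (coneFrom b F) :=
  (isCompact_Icc.prod hF).image (by fun_prop)

theorem bijective_coprod_toSpanSingleton_ker {E : Type*} [AddCommGroup E] [Module ℝ E]
    (l : E →ₗ[ℝ] ℝ) {w : E} (hw : l w ≠ 0) :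
    Function.Bijective ((LinearMap.toSpanSingleton ℝ E w).coprod (LinearMap.ker l).subtype) := by
  constructor
  · rw [← LinearMap.ker_eq_bot, LinearMap.ker_eq_bot']
    rintro ⟨t, v, hv⟩ h
    simp only [LinearMap.coprod_apply, LinearMap.toSpanSingleton_apply,
      Submodule.subtype_apply] at h
    have h' := congrArg l h
    rw [map_add, LinearMap.mem_ker.1 hv, map_smul, smul_eq_mul, add_zero, map_zero] at h'
    obtain rfl := (mul_eq_zero.1 h').resolve_right hw
    simpa using h
  · intro z
    refine ⟨(l z / l w, ⟨z - (l z / l w) • w, ?_⟩), ?_⟩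
    · simp [hw]
    · simp

/-- A convex function on a cone is, on average, at most the average of its linear interpolation
between the apex and the base. -/
theorem setIntegral_coneFrom_le {E : Type*} [NormedAddCommGroup E] [NormedSpace ℝ E]
    [FiniteDimensional ℝ E] [MeasurableSpace E] [BorelSpace E] (μ : Measure E)
    [μ.IsAddHaarMeasure] {m : ℕ} (hm : finrank ℝ E = m + 1) (l : E →ₗ[ℝ] ℝ) {b p : E}
    (hl : l (p - b) ≠ 0) {F : Set E} (hF : IsCompact F) (hFc : Convex ℝ F)
    (hFl : ∀ y ∈ F, l (y - p) = 0) {K : Set E} {f : E → ℝ} (hf : ConvexOn ℝ K f)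
    (hK : IsCompact K) (hb : BddAbove (f '' K)) (hbK : b ∈ K) (hFK : F ⊆ K) :
    ∫ y in coneFrom b F, f y ∂μ ≤ μ.real (coneFrom b F) *
      (1 / (m + 2) * f b + (m + 1) / (m + 2) * ⨍ y in F, f y ∂μH[(m : ℝ)]) := by
  let V := LinearMap.ker l
  let A : (ℝ × V) ≃ᵃ[ℝ] E :=
    (LinearEquiv.ofBijective _ (bijective_coprod_toSpanSingleton_ker l hl)).toAffineEquiv.trans
      (AffineEquiv.constVAdd ℝ E b)
  have hA : ∀ z : ℝ × V, A z = b + (z.1 • (p - b) + z.2) := fun z => rfl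
  have hVm : finrank ℝ V = m := by
    have := (LinearEquiv.ofBijective _ (bijective_coprod_toSpanSingleton_ker l hl)).finrank_eq
    rw [Module.finrank_prod, Module.finrank_self] at this
    change 1 + finrank ℝ V = _ at this
    omega
  have hHaar : (μH[(m : ℝ)] : Measure V).IsAddHaarMeasure := by
    rw [← hVm]; infer_instance
  let i : V → E := fun v => p + v
  have hi : Isometry i := fun u v => by simp only [i, edist_add_left]; rfl
  have hFi : F ⊆ range i := fun y hy =>
    ⟨⟨y - p, LinearMap.mem_ker.2 (hFl y hy)⟩, by simp [i]⟩
  have hS : IsCompact (i ⁻¹' F) := hi.isClosedEmbedding.isCompact_preimage hF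
  have hSc : Convex ℝ (i ⁻¹' F) :=
    (hFc.translate_preimage_right p).linear_preimage V.subtype
  have hAi : ∀ (t : ℝ) (u : V), A (t, t • u) = b + t • (i u - b) := by
    intro t u
    simp only [hA, i, Submodule.coe_smul]
    module
  have hAC : A ⁻¹' coneFrom b F = coneOver (i ⁻¹' F) := by
    have : coneFrom b F = A '' coneOver (i ⁻¹' F) := by
      ext y
      simp only [coneFrom, coneOver, image_image, mem_image, mem_prod, Prod.exists, hAi]
      constructor
      · rintro ⟨t, y, ⟨ht, hy⟩, rfl⟩
        obtain ⟨u, rfl⟩ := hFi hy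
        exact ⟨t, u, ⟨ht, hy⟩, rfl⟩
      · rintro ⟨t, u, ⟨ht, hu⟩, rfl⟩
        exact ⟨t, i u, ⟨ht, hu⟩, rfl⟩
    rw [this, preimage_image_eq _ A.injective]
  have hAme : MeasurableEmbedding A :=
    A.toContinuousAffineEquiv.toHomeomorph.measurableEmbedding
  obtain ⟨c, hc⟩ :=
    exists_map_affineEquiv_eq_smul ((volume : Measure ℝ).prod (μH[(m : ℝ)] : Measure V)) μ A
  have hAK : ConvexOn ℝ (A ⁻¹' K) (f ∘ A) := hf.comp_affineMap A.toAffineMap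
  have hA0 : A 0 = b := by simp [hA]
  have hA1 : ∀ u : V, A (1, u) = i u := fun u => by
    simp only [hA, i, one_smul]
    abel
  have hAKc : IsCompact (A ⁻¹' K) :=
    A.toContinuousAffineEquiv.toHomeomorph.isClosedEmbedding.isCompact_preimage hK
  have hAb : BddAbove ((f ∘ A) '' (A ⁻¹' K)) := by
    refine hb.mono ?_
    rintro _ ⟨z, hz, rfl⟩
    exact ⟨_, hz, rfl⟩
  have hsub : coneOver (i ⁻¹' F) ⊆ A ⁻¹' K := by
    rw [← hAC]
    refine preimage_mono ?_
    rintro _ ⟨⟨t, y⟩, ⟨ht, hy⟩, rfl⟩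
    exact hf.1.add_smul_sub_mem hbK (hFK hy) ht
  have key := setIntegral_coneOver_le (μH[(m : ℝ)] : Measure V) hS hSc hAK hAb
    (by rwa [mem_preimage, hA0]) (fun u hu => by rw [mem_preimage, hA1]; exact hFK hu)
    ((hAK.integrableOn_of_isCompact _ hAKc hAb).mono_set hsub)
  have hint : ∫ y in coneFrom b F, f y ∂μ = c * ∫ z in coneOver (i ⁻¹' F), (f ∘ A) z
      ∂((volume : Measure ℝ).prod (μH[(m : ℝ)] : Measure V)) := by
    rw [hc, Measure.restrict_smul, integral_smul_nnreal_measure, hAme.setIntegral_map, hAC]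
    rfl
  have hreal : μ.real (coneFrom b F) =
      c * ((volume : Measure ℝ).prod (μH[(m : ℝ)] : Measure V)).real (coneOver (i ⁻¹' F)) := by
    rw [hc, measureReal_nnreal_smul_apply, measureReal_def, hAme.map_apply, hAC, measureReal_def]
  rw [hint, hreal, setAverage_preimage_isometry hi m.cast_nonneg hF.measurableSet hFi, mul_assoc]
  simp only [Function.comp_apply, hA0, hA1, hVm] at key
  exact mul_le_mul_of_nonneg_left key c.2

namespace AffineBasis

variable {ι E : Type*} [NormedAddCommGroup E] [NormedSpace ℝ E]

theorem convexHull_image_erase [Fintype ι] [DecidableEq ι] (B : AffineBasis ι ℝ E) (i : ι) :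
    convexHull ℝ (B '' (↑(Finset.univ.erase i) : Set ι)) =
      {y | (∀ j, 0 ≤ B.coord j y) ∧ B.coord i y = 0} := by
  apply subset_antisymm
  · intro y hy
    refine ⟨?_, ?_⟩
    · have : y ∈ convexHull ℝ (range B) := convexHull_mono (image_subset_range _ _) hy
      rwa [B.convexHull_eq_nonneg_coord] at this
    · have hconv : Convex ℝ {y | B.coord i y = 0} :=
        (convex_singleton (0 : ℝ)).affine_preimage (B.coord i)
      refine convexHull_min ?_ hconv hy
      rintro _ ⟨j, hj, rfl⟩
      exact B.coord_apply_ne (by rintro rfl; simp at hj)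
  · rintro y ⟨hy, hyi⟩
    have hsum : ∑ j ∈ Finset.univ.erase i, B.coord j y = 1 := by
      rw [Finset.sum_erase (f := fun j => B.coord j y) _ hyi, B.sum_coord_apply_eq_one]
    have hcomb : ∑ j ∈ Finset.univ.erase i, B.coord j y • B j = y := by
      rw [Finset.sum_erase _ (by simp [hyi]), B.linear_combination_coord_eq_self]
    rw [← hcomb]
    exact (convex_convexHull ℝ _).sum_mem (fun j _ => hy j) hsum
      fun j hj => subset_convexHull _ _ ⟨j, hj, rfl⟩

/-- The points of the simplex spanned by `B` whose `i`-th barycentric coordinate is minimal. -/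
def minCell (B : AffineBasis ι ℝ E) (i : ι) : Set E :=
  {y | 0 ≤ B.coord i y ∧ ∀ j, B.coord i y ≤ B.coord j y}

theorem iUnion_minCell [Fintype ι] (B : AffineBasis ι ℝ E) :
    ⋃ i, B.minCell i = convexHull ℝ (range B) := by
  have := B.nonempty
  rw [B.convexHull_eq_nonneg_coord]
  ext y
  simp only [mem_iUnion, minCell, mem_ofPred_eq]
  constructor
  · rintro ⟨i, h0, hi⟩ j
    exact h0.trans (hi j)
  · intro h
    obtain ⟨i, hi⟩ := Finite.exists_min fun j => B.coord j y
    exact ⟨i, h i, hi⟩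

theorem coord_sum_smul [Fintype ι] (B : AffineBasis ι ℝ E) {w : ι → ℝ}
    (hw : ∑ i, w i = 1) (i : ι) :
    B.coord i (∑ j, w j • B j) = w i := by
  rw [← Finset.univ.affineCombination_eq_linear_combination _ _ hw,
    B.coord_apply_combination_of_mem (Finset.mem_univ i) hw]

theorem coord_inv_card_smul_sum [Fintype ι] (B : AffineBasis ι ℝ E) (i : ι) :
    B.coord i ((Fintype.card ι : ℝ)⁻¹ • ∑ j, B j) = (Fintype.card ι : ℝ)⁻¹ := by
  have := B.nonempty
  rw [Finset.smul_sum, B.coord_sum_smul (w := fun _ => (Fintype.card ι : ℝ)⁻¹)]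
  simp

theorem minCell_eq_coneFrom [Fintype ι] [DecidableEq ι] [Nontrivial ι]
    (B : AffineBasis ι ℝ E) (i : ι) :
    B.minCell i = coneFrom ((Fintype.card ι : ℝ)⁻¹ • ∑ j, B j)
      (convexHull ℝ (B '' (↑(Finset.univ.erase i) : Set ι))) := by
  have hN : (0 : ℝ) < Fintype.card ι := by exact_mod_cast Fintype.card_pos
  set N : ℝ := (Fintype.card ι : ℝ) with hNdef
  set b : E := N⁻¹ • ∑ j, B j with hb
  have hline : ∀ (j : ι) (t : ℝ) (y : E),
      B.coord j (b + t • (y - b)) = N⁻¹ + t * (B.coord j y - N⁻¹) := by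
    intro j t y
    have := (B.coord j).apply_lineMap b y t
    rw [B.coord_inv_card_smul_sum, AffineMap.lineMap_apply, AffineMap.lineMap_apply] at this
    simp only [vsub_eq_sub, vadd_eq_add, smul_eq_mul] at this
    rw [add_comm, this, add_comm]
  rw [convexHull_image_erase]
  ext y
  constructor
  · rintro ⟨h0, hmin⟩
    set a := B.coord i y with ha
    have hsum : ∑ j, (B.coord j y - a) = 1 - N * a := by
      rw [Finset.sum_sub_distrib, B.sum_coord_apply_eq_one]; simp [hNdef]
    have ht0 : 0 ≤ 1 - N * a := hsum ▸ Finset.sum_nonneg fun j _ => sub_nonneg.2 (hmin j)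
    rcases ht0.eq_or_lt with ht | ht
    · obtain ⟨k, hk⟩ := exists_ne i
      refine ⟨(0, B k), ⟨⟨le_rfl, zero_le_one⟩, ?_, B.coord_apply_ne hk.symm⟩, ?_⟩
      · intro j
        rw [B.coord_apply]
        split_ifs <;> norm_num
      · have hall := (Finset.sum_eq_zero_iff_of_nonneg
          fun j _ => sub_nonneg.2 (hmin j)).1 (hsum.trans ht.symm)
        refine B.ext_elem fun j => ?_
        have hj := hall j (Finset.mem_univ j)
        rw [hline]
        field_simp
        linear_combination -N * hj - ht
    · refine ⟨(1 - N * a, b + (1 - N * a)⁻¹ • (y - b)),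
        ⟨⟨ht.le, by nlinarith⟩, fun j => ?_, ?_⟩, ?_⟩
      · rw [hline]
        have : N⁻¹ + (1 - N * a)⁻¹ * (B.coord j y - N⁻¹) = (B.coord j y - a) / (1 - N * a) := by
          field_simp
          ring
        rw [this]
        exact div_nonneg (sub_nonneg.2 (hmin j)) ht.le
      · rw [hline, ← ha]
        field_simp
        ring
      · simp [smul_smul, ht.ne']
  · rintro ⟨⟨t, z⟩, ⟨ht, hz, hzi⟩, rfl⟩
    simp only [minCell, mem_ofPred_eq, hline, hzi]
    have hNi : 0 < N⁻¹ := inv_pos.2 hN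
    refine ⟨by nlinarith [ht.2], fun j => ?_⟩
    have := mul_nonneg ht.1 (hz j)
    linarith

theorem isCompact_convexHull_range [Fintype ι] (B : AffineBasis ι ℝ E) :
    IsCompact (convexHull ℝ (range B)) :=
  (finite_range B).isCompact_convexHull ℝ

variable [FiniteDimensional ℝ E]

theorem isClosed_minCell (B : AffineBasis ι ℝ E) (i : ι) : IsClosed (B.minCell i) := by
  have hcont : ∀ j, Continuous (B.coord j) := fun j => (B.coord j).continuous_of_finiteDimensional
  simp only [minCell, ofPred_and, ofPred_forall]
  exact (isClosed_le continuous_const (hcont i)).inter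
    (isClosed_iInter fun j => isClosed_le (hcont i) (hcont j))

variable [MeasurableSpace E] (μ : Measure E) [μ.IsAddHaarMeasure]

theorem measure_convexHull_range_ne_zero (B : AffineBasis ι ℝ E) :
    μ (convexHull ℝ (range B)) ≠ 0 := by
  refine ((Measure.measure_pos_of_nonempty_interior μ ?_)).ne'
  exact interior_convexHull_nonempty_iff_affineSpan_eq_top.2 B.tot

variable [BorelSpace E]

theorem aedisjoint_minCell (B : AffineBasis ι ℝ E) :
    Pairwise (Function.onFun (AEDisjoint μ) B.minCell) := by
  intro i j hij
  let P : AffineSubspace ℝ E := (AffineSubspace.mk' (0 : ℝ) ⊥).comap (B.coord i - B.coord j)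
  have hP : ∀ y, y ∈ P ↔ B.coord i y = B.coord j y := fun y => by
    simp [P, AffineSubspace.mem_comap, sub_eq_zero]
  refine measure_mono_null (t := (P : Set E)) ?_ (Measure.addHaar_affineSubspace μ P fun h => ?_)
  · rintro y ⟨hi, hj⟩
    exact (hP y).2 (le_antisymm (hi.2 j) (hj.2 i))
  · have : B i ∈ P := h ▸ AffineSubspace.mem_top ℝ E (B i)
    rw [hP, B.coord_apply_eq, B.coord_apply_ne hij.symm] at this
    exact one_ne_zero this

theorem measure_minCell_eq [Fintype ι] (B : AffineBasis ι ℝ E) (i j : ι) :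
    μ (B.minCell i) = μ (B.minCell j) := by
  classical
  let σ : Equiv.Perm ι := Equiv.swap i j
  let T : E →ᵃ[ℝ] E :=
    (Fintype.linearCombination ℝ fun k => B (σ k)).toAffineMap.comp B.coords
  have hT : ∀ y, T y = ∑ k, B.coord k y • B (σ k) := fun y => rfl
  have hcoord : ∀ k y, B.coord (σ k) (T y) = B.coord k y := by
    intro k y
    have h := σ.symm.sum_comp fun l => B.coord l y • B (σ l)
    rw [hT, ← h]
    simp only [Equiv.apply_symm_apply]
    rw [B.coord_sum_smul (w := fun l => B.coord (σ.symm l) y), Equiv.symm_apply_apply]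
    rw [σ.symm.sum_comp fun l => B.coord l y, B.sum_coord_apply_eq_one]
  have hinj : Function.Injective T := fun y z h => B.ext_elem fun k => by
    rw [← hcoord, h, hcoord]
  have hbij : Function.Bijective T :=
    ⟨hinj, T.linear_surjective_iff.1 (LinearMap.injective_iff_surjective.1
      (T.linear_injective_iff.2 hinj))⟩
  let A : E ≃ᵃ[ℝ] E := AffineEquiv.ofBijective hbij
  have hAT : ∀ y, A y = T y := fun y => rfl
  have hAme : MeasurableEmbedding A :=
    A.toContinuousAffineEquiv.toHomeomorph.measurableEmbedding
  obtain ⟨c, hc⟩ := exists_map_affineEquiv_eq_smul μ μ A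
  have hsimplex : A ⁻¹' convexHull ℝ (range B) = convexHull ℝ (range B) := by
    rw [B.convexHull_eq_nonneg_coord]
    ext y
    simp only [mem_preimage, mem_ofPred_eq, hAT]
    rw [← σ.forall_congr_right]
    simp only [hcoord]
  have hcell : A ⁻¹' B.minCell j = B.minCell i := by
    ext y
    have hi := hcoord i y
    rw [show σ i = j from Equiv.swap_apply_left i j] at hi
    simp only [mem_preimage, minCell, mem_ofPred_eq, hAT, hi]
    rw [← σ.forall_congr_right]
    simp only [hcoord]
  have happly : ∀ s, μ s = c • μ (A ⁻¹' s) := fun s => by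
    conv_lhs => rw [hc]
    rw [Measure.smul_apply, hAme.map_apply]
  have hc1 : (c : ENNReal) = 1 := by
    have h := happly (convexHull ℝ (range B))
    rw [hsimplex, ENNReal.smul_def, smul_eq_mul] at h
    exact (ENNReal.mul_eq_right (B.measure_convexHull_range_ne_zero μ)
      B.isCompact_convexHull_range.measure_lt_top.ne).1 h.symm
  rw [happly (B.minCell j), hcell, ENNReal.smul_def, hc1, one_smul]

theorem setIntegral_convexHull_range [Fintype ι] (B : AffineBasis ι ℝ E) {f : E → ℝ}
    (hf : IntegrableOn f (convexHull ℝ (range B)) μ) :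
    ∫ y in convexHull ℝ (range B), f y ∂μ = ∑ i, ∫ y in B.minCell i, f y ∂μ := by
  rw [← B.iUnion_minCell] at hf ⊢
  rw [integral_iUnion_ae (fun i => (B.isClosed_minCell i).measurableSet.nullMeasurableSet)
    (B.aedisjoint_minCell μ) hf, tsum_fintype]

theorem measureReal_minCell [Fintype ι] (B : AffineBasis ι ℝ E) (i : ι) :
    μ.real (B.minCell i) = μ.real (convexHull ℝ (range B)) / Fintype.card ι := by
  have := B.nonempty
  have h := B.setIntegral_convexHull_range μ (f := fun _ => 1)
    (integrableOn_const B.isCompact_convexHull_range.measure_lt_top.ne)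
  simp only [setIntegral_const, smul_eq_mul, mul_one] at h
  rw [h, Finset.sum_congr rfl fun j _ => by
    rw [measureReal_def, B.measure_minCell_eq μ j i, ← measureReal_def]]
  simp

/-- Averages of a convex function over a simplex are controlled by its value at the barycenter
and its averages over the facets. -/
theorem setAverage_convexHull_range_le [Fintype ι] [DecidableEq ι] (B : AffineBasis ι ℝ E) {m : ℕ}
    (hm : finrank ℝ E = m + 1) {f : E → ℝ} (hf : ConvexOn ℝ (convexHull ℝ (range B)) f) :
    ⨍ y in convexHull ℝ (range B), f y ∂μ ≤
      1 / (m + 2) * f ((Fintype.card ι : ℝ)⁻¹ • ∑ i, B i) +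
        (m + 1) / (m + 2) * (1 / (m + 2) * ∑ i : ι,
          ⨍ y in convexHull ℝ (B '' (↑(Finset.univ.erase i) : Set ι)), f y ∂μH[(m : ℝ)]) := by
  have hcard : Fintype.card ι = m + 2 := by
    rw [B.card_eq_finrank_add_one, hm]
  have : Nontrivial ι := Fintype.one_lt_card_iff_nontrivial.1 (by omega)
  have hcardR : (Fintype.card ι : ℝ) = m + 2 := by rw [hcard]; push_cast; ring
  have hK := B.isCompact_convexHull_range
  have hbdd : BddAbove (f '' convexHull ℝ (range B)) :=
    hf.bddAbove_convexHull (subset_convexHull _ _) ((finite_range B).image f).bddAbove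
  set b := (Fintype.card ι : ℝ)⁻¹ • ∑ i, B i with hb
  have hbK : b ∈ convexHull ℝ (range B) := by
    rw [B.convexHull_eq_nonneg_coord]
    intro i
    rw [B.coord_inv_card_smul_sum]
    positivity
  have hpos : 0 < μ.real (convexHull ℝ (range B)) :=
    ENNReal.toReal_pos (B.measure_convexHull_range_ne_zero μ) hK.measure_lt_top.ne
  have hcell : ∀ i, ∫ y in B.minCell i, f y ∂μ ≤
      μ.real (convexHull ℝ (range B)) / (m + 2) * (1 / (m + 2) * f b + (m + 1) / (m + 2) *
        ⨍ y in convexHull ℝ (B '' (↑(Finset.univ.erase i) : Set ι)), f y ∂μH[(m : ℝ)]) := by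
    intro i
    obtain ⟨k, hk⟩ := exists_ne i
    rw [← hcardR, ← B.measureReal_minCell μ i, hcardR, B.minCell_eq_coneFrom i]
    refine setIntegral_coneFrom_le μ hm (B.coord i).linear (p := B k) ?_
      (((Finset.finite_toSet _).image B).isCompact_convexHull ℝ) (convex_convexHull ℝ _) ?_ hf hK
      hbdd hbK (convexHull_mono (image_subset_range _ _))
    · rw [← vsub_eq_sub, AffineMap.linearMap_vsub, B.coord_apply_ne hk.symm,
        B.coord_inv_card_smul_sum, hcardR, vsub_eq_sub, zero_sub]
      exact neg_ne_zero.2 (by positivity)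
    · intro y hy
      rw [B.convexHull_image_erase] at hy
      rw [← vsub_eq_sub, AffineMap.linearMap_vsub, B.coord_apply_ne hk.symm, hy.2, vsub_self]
  rw [setAverage_eq, smul_eq_mul, inv_mul_le_iff₀ hpos,
    B.setIntegral_convexHull_range μ (hf.integrableOn_of_isCompact μ hK hbdd)]
  refine (Finset.sum_le_sum fun i _ => hcell i).trans_eq ?_
  rw [← Finset.mul_sum, Finset.sum_add_distrib, Finset.sum_const, ← Finset.mul_sum,
    Finset.card_univ, nsmul_eq_mul, hcardR]
  field_simp

end AffineBasis

end SimplexAverage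

theorem avg_le_barycenter_facets (n : ℕ) (x : Fin (n + 1) → EuclideanSpace ℝ (Fin n))
    (hx : AffineIndependent ℝ x) (f : EuclideanSpace ℝ (Fin n) → ℝ)
    (hf : ConvexOn ℝ (convexHull ℝ (Set.range x)) f) :
    avgH f (n : ℝ) (convexHull ℝ (Set.range x)) ≤
      (1 / ((n : ℝ) + 1)) * f (((n : ℝ) + 1)⁻¹ • ∑ i, x i) +
        ((n : ℝ) / ((n : ℝ) + 1)) * (1 / ((n : ℝ) + 1)) *
          ∑ i : Fin (n + 1),
            avgH f ((n : ℝ) - 1) (convexHull ℝ (x '' ↑(Finset.univ.erase i))) := by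
  unfold avgH
  rcases n with _ | m
  · have hconst : f = fun _ => f (x 0) := funext fun y => congrArg f (Subsingleton.elim _ _)
    rw [hconst]
    simp [Set.range_unique]
  · have hfin : Module.finrank ℝ (EuclideanSpace ℝ (Fin (m + 1))) = m + 1 := by simp
    let B : AffineBasis (Fin (m + 1 + 1)) ℝ (EuclideanSpace ℝ (Fin (m + 1))) :=
      ⟨x, hx, hx.affineSpan_eq_top_iff_card_eq_finrank_add_one.2 (by simp)⟩
    have hHaar : (μH[((m + 1 : ℕ) : ℝ)] :
        Measure (EuclideanSpace ℝ (Fin (m + 1)))).IsAddHaarMeasure := by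
      conv in ((m + 1 : ℕ) : ℝ) => rw [← hfin]
      infer_instance
    have h := B.setAverage_convexHull_range_le μH[((m + 1 : ℕ) : ℝ)] hfin hf
    have hB : (B : Fin (m + 1 + 1) → _) = x := rfl
    rw [hB, Fintype.card_fin] at h
    have h1 : ((m + 1 : ℕ) : ℝ) - 1 = m := by push_cast; ring
    have h2 : ((m + 1 : ℕ) : ℝ) + 1 = m + 2 := by push_cast; ring
    have h3 : ((m + 1 + 1 : ℕ) : ℝ) = m + 2 := by push_cast; ring
    rw [h3] at h
    rw [h1, h2, mul_assoc]
    refine h.trans_eq ?_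
    push_cast
    rfl
end

section
/- Let Δ ⊂ ℝⁿ be a nondegenerate simplex with vertices x₀,…,xₙ and barycenter b. For every convex f : Δ → ℝ, Avg(f, Δ) ≤ (1/(n+1))·f(b) + (n/(n+1))·(f(x₀)+⋯+f(xₙ))/(n+1). -/
open MeasureTheory

namespace AffineBasis

/-- The image of a simplex under a homothety, in barycentric coordinates. -/
theorem homothety_image_convexHull {ι E : Type*} [AddCommGroup E] [Module ℝ E]
    (b : AffineBasis ι ℝ E) (c : E) {r : ℝ} (hr : 0 < r) :
    AffineMap.homothety c r '' convexHull ℝ (Set.range b) =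
      {y | ∀ i, (1 - r) * b.coord i c ≤ b.coord i y} := by
  have hcoord (p : E) (s : ℝ) (i : ι) :
      b.coord i (AffineMap.homothety c s p) = (1 - s) * b.coord i c + s * b.coord i p := by
    rw [AffineMap.homothety_eq_lineMap, AffineMap.apply_lineMap, AffineMap.lineMap_apply_ring]
  rw [b.convexHull_eq_nonneg_coord]
  ext y
  constructor
  · rintro ⟨z, hz, rfl⟩ i
    rw [hcoord]
    nlinarith [mul_nonneg hr.le (hz i)]
  · intro hy
    refine ⟨AffineMap.homothety c r⁻¹ y, fun i => ?_, ?_⟩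
    · rw [hcoord]
      have h : (1 - r⁻¹) * b.coord i c + r⁻¹ * b.coord i y =
          r⁻¹ * (b.coord i y - (1 - r) * b.coord i c) := by
        field_simp
        ring
      rw [h]
      exact mul_nonneg (by positivity) (sub_nonneg.2 (hy i))
    · rw [← AffineMap.homothety_mul_apply, mul_inv_cancel₀ hr.ne', AffineMap.homothety_one,
        AffineMap.id_apply]

theorem isCompact_convexHull_range_s12 {ι E : Type*} [Finite ι] [NormedAddCommGroup E]
    [NormedSpace ℝ E] (b : AffineBasis ι ℝ E) :
    IsCompact (convexHull ℝ (Set.range b)) :=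
  (Set.finite_range b).isCompact_convexHull ℝ

section Jensen

variable {ι E : Type*} [Fintype ι] [AddCommGroup E] [Module ℝ E]

theorem coord_smul_sum_eq (b : AffineBasis ι ℝ E) (i : ι) :
    b.coord i ((Fintype.card ι : ℝ)⁻¹ • ∑ j, b j) = (Fintype.card ι : ℝ)⁻¹ := by
  have : Nonempty ι := ⟨i⟩
  have hw : ∑ _j : ι, (Fintype.card ι : ℝ)⁻¹ = 1 := by simp
  rw [Finset.smul_sum, ← Finset.univ.affineCombination_eq_linear_combination b _ hw]
  exact b.coord_apply_combination_of_mem (Finset.mem_univ i) hw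

theorem smul_sum_mem_convexHull_range (b : AffineBasis ι ℝ E) :
    (Fintype.card ι : ℝ)⁻¹ • ∑ j, b j ∈ convexHull ℝ (Set.range b) := by
  rw [b.convexHull_eq_nonneg_coord]
  intro i
  rw [b.coord_smul_sum_eq]
  positivity

/-- Jensen's inequality for a convex combination of a point and the vertices of a simplex. -/
theorem map_smul_add_sum_le (b : AffineBasis ι ℝ E) {f : E → ℝ}
    (hf : ConvexOn ℝ (convexHull ℝ (Set.range b)) f) {z : E}
    (hz : z ∈ convexHull ℝ (Set.range b)) {a : ℝ} (ha : 0 ≤ a) {w : ι → ℝ} (hw : ∀ i, 0 ≤ w i)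
    (hsum : a + ∑ i, w i = 1) :
    f (a • z + ∑ i, w i • b i) ≤ a * f z + ∑ i, w i * f (b i) := by
  have h := hf.map_sum_le (t := Finset.univ) (w := fun o : Option ι => o.elim a w)
    (p := fun o : Option ι => o.elim z b) ?_ ?_ ?_
  · simpa [Fintype.sum_option] using h
  · rintro (_ | i) _
    exacts [ha, hw i]
  · simpa [Fintype.sum_option] using hsum
  · rintro (_ | i) _
    exacts [hz, subset_convexHull ℝ _ (Set.mem_range_self i)]

/-- A convex function on a simplex is bounded above by the interpolation of its values at the
vertices and at the barycenter, with any admissible weight `t` on the barycenter. -/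
theorem map_le_of_forall_mul_le_coord (b : AffineBasis ι ℝ E) {f : E → ℝ}
    (hf : ConvexOn ℝ (convexHull ℝ (Set.range b)) f) {y : E} {t : ℝ} (ht : 0 ≤ t)
    (hty : ∀ i, t * (Fintype.card ι : ℝ)⁻¹ ≤ b.coord i y) :
    f y ≤ t * f ((Fintype.card ι : ℝ)⁻¹ • ∑ j, b j) +
      ∑ i, (b.coord i y - t * (Fintype.card ι : ℝ)⁻¹) * f (b i) := by
  have : Nonempty ι := b.nonempty
  have h := b.map_smul_add_sum_le hf b.smul_sum_mem_convexHull_range ht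
    (w := fun i => b.coord i y - t * (Fintype.card ι : ℝ)⁻¹)
    (fun i => sub_nonneg.2 (hty i)) ?_
  · convert h using 2
    simp only [sub_smul, Finset.sum_sub_distrib, b.linear_combination_coord_eq_self, mul_smul,
      ← Finset.smul_sum]
    abel
  · have hN : (Fintype.card ι : ℝ) ≠ 0 := by positivity
    simp [Finset.sum_sub_distrib, b.sum_coord_apply_eq_one]
    field_simp
    ring

/-- A convex function on a simplex is bounded below by an affine function. -/
theorem le_map_of_mem_convexHull (b : AffineBasis ι ℝ E) {f : E → ℝ}
    (hf : ConvexOn ℝ (convexHull ℝ (Set.range b)) f) {y : E}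
    (hy : y ∈ convexHull ℝ (Set.range b)) :
    Fintype.card ι * f ((Fintype.card ι : ℝ)⁻¹ • ∑ j, b j) -
      ∑ i, (1 - b.coord i y) * f (b i) ≤ f y := by
  have : Nonempty ι := b.nonempty
  have hN : (0 : ℝ) < Fintype.card ι := by positivity
  have hy' := hy
  rw [b.convexHull_eq_nonneg_coord] at hy'
  have hle (i : ι) : b.coord i y ≤ 1 := by
    rw [← b.sum_coord_apply_eq_one y]
    exact Finset.single_le_sum (fun j _ => hy' j) (Finset.mem_univ i)
  have h := b.map_smul_add_sum_le hf hy (a := (Fintype.card ι : ℝ)⁻¹) (by positivity)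
    (w := fun i => (Fintype.card ι : ℝ)⁻¹ * (1 - b.coord i y))
    (fun i => mul_nonneg (by positivity) (sub_nonneg.2 (hle i))) ?_
  · have hc : (Fintype.card ι : ℝ)⁻¹ • y +
        ∑ i, ((Fintype.card ι : ℝ)⁻¹ * (1 - b.coord i y)) • b i =
        (Fintype.card ι : ℝ)⁻¹ • ∑ j, b j := by
      simp only [mul_smul, ← Finset.smul_sum, sub_smul, Finset.sum_sub_distrib, one_smul,
        b.linear_combination_coord_eq_self, ← smul_add]
      congr 1
      abel
    rw [hc] at h
    simp only [mul_assoc, ← Finset.mul_sum, ← mul_add] at h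
    rw [le_inv_mul_iff₀ hN] at h
    linarith
  · rw [← Finset.mul_sum, Finset.sum_sub_distrib, b.sum_coord_apply_eq_one]
    simp
    field_simp
    ring

end Jensen

section Integral

variable {ι E : Type*} [Fintype ι] [NormedAddCommGroup E] [NormedSpace ℝ E]
  [FiniteDimensional ℝ E] [MeasurableSpace E] [BorelSpace E]

theorem integrableOn_convexHull (b : AffineBasis ι ℝ E) (μ : Measure E) [μ.IsAddHaarMeasure]
    {f : E → ℝ} (hf : ConvexOn ℝ (convexHull ℝ (Set.range b)) f) :
    IntegrableOn f (convexHull ℝ (Set.range b)) μ := by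
  have hcpt := b.isCompact_convexHull_range_s12
  have hcoord (i : ι) : Continuous (b.coord i) := continuous_barycentric_coord b i
  have hmem : ∀ᵐ y ∂μ.restrict (convexHull ℝ (Set.range b)), y ∈ convexHull ℝ (Set.range b) :=
    ae_restrict_mem hcpt.measurableSet
  refine integrable_of_le_of_le (g₁ := fun y =>
    Fintype.card ι * f ((Fintype.card ι : ℝ)⁻¹ • ∑ j, b j) - ∑ i, (1 - b.coord i y) * f (b i))
    (g₂ := fun y => ∑ i, b.coord i y * f (b i)) ?_ ?_ ?_ ?_ ?_
  · have hfr := (convex_convexHull ℝ (Set.range b)).addHaar_frontier μ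
    have hae : interior (convexHull ℝ (Set.range b)) =ᵐ[μ] convexHull ℝ (Set.range b) :=
      interior_ae_eq_of_null_frontier hfr
    rw [← Measure.restrict_congr_set hae]
    exact hf.continuousOn_interior.aestronglyMeasurable isOpen_interior.measurableSet
  · filter_upwards [hmem] with y hy using b.le_map_of_mem_convexHull hf hy
  · filter_upwards [hmem] with y hy
    rw [b.convexHull_eq_nonneg_coord] at hy
    simpa using b.map_le_of_forall_mul_le_coord hf (t := 0) le_rfl (by simpa using hy)
  · exact (Continuous.continuousOn (by fun_prop)).integrableOn_compact hcpt
  · exact (Continuous.continuousOn (by fun_prop)).integrableOn_compact hcpt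

/-- The integral over a simplex of a function whose superlevel sets are homothetic copies of the
simplex about a fixed center `c`. -/
theorem setIntegral_eq_of_superlevel (b : AffineBasis ι ℝ E) (μ : Measure E) [μ.IsAddHaarMeasure]
    {c : E} {g : E → ℝ} (hg : Continuous g)
    (hg0 : ∀ y ∈ convexHull ℝ (Set.range b), 0 ≤ g y)
    (hg1 : ∀ y ∈ convexHull ℝ (Set.range b), g y ≤ 1)
    (hgc : ∀ t, 0 < t → ∀ y, (∀ i, t * b.coord i c ≤ b.coord i y) ↔
      y ∈ convexHull ℝ (Set.range b) ∧ t ≤ g y) :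
    ∫ y in convexHull ℝ (Set.range b), g y ∂μ =
      (Fintype.card ι : ℝ)⁻¹ * μ.real (convexHull ℝ (Set.range b)) := by
  have hcpt := b.isCompact_convexHull_range_s12
  set S := convexHull ℝ (Set.range b) with hS
  have hmem : ∀ᵐ y ∂μ.restrict S, y ∈ S := ae_restrict_mem hcpt.measurableSet
  have hint : IntegrableOn g S μ := hg.continuousOn.integrableOn_compact hcpt
  have hlevel (t : ℝ) (ht : t ∈ Set.Ioo (0 : ℝ) 1) :
      (μ.restrict S).real {y | t ≤ g y} = (1 - t) ^ Module.finrank ℝ E * μ.real S := by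
    have hset : {y | t ≤ g y} ∩ S = AffineMap.homothety c (1 - t) '' S := by
      rw [hS, b.homothety_image_convexHull c (sub_pos.2 ht.2)]
      ext y
      simp only [sub_sub_cancel, Set.mem_inter_iff, Set.mem_ofPred_eq]
      rw [hgc t ht.1 y, and_comm]
    rw [measureReal_restrict_apply (measurableSet_le measurable_const hg.measurable), hset,
      measureReal_def, Measure.addHaar_image_homothety, ENNReal.toReal_mul,
      ENNReal.toReal_ofReal (abs_nonneg _),
      abs_of_nonneg (pow_nonneg (sub_nonneg.2 ht.2.le) _), measureReal_def]
  rw [hint.integral_eq_integral_Ioc_meas_le (M := 1)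
    (by filter_upwards [hmem] with y hy using hg0 y hy)
    (by filter_upwards [hmem] with y hy using hg1 y hy), integral_Ioc_eq_integral_Ioo,
    setIntegral_congr_fun measurableSet_Ioo hlevel, ← integral_Ioc_eq_integral_Ioo,
    ← intervalIntegral.integral_of_le zero_le_one, intervalIntegral.integral_mul_const,
    intervalIntegral.integral_comp_sub_left (fun t => t ^ Module.finrank ℝ E), integral_pow,
    b.card_eq_finrank_add_one]
  simp

theorem setIntegral_coord (b : AffineBasis ι ℝ E) (μ : Measure E) [μ.IsAddHaarMeasure] (k : ι) :
    ∫ y in convexHull ℝ (Set.range b), b.coord k y ∂μ =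
      (Fintype.card ι : ℝ)⁻¹ * μ.real (convexHull ℝ (Set.range b)) := by
  classical
  refine b.setIntegral_eq_of_superlevel μ (c := b k) (continuous_barycentric_coord b k) ?_ ?_ ?_
  · intro y hy
    rw [b.convexHull_eq_nonneg_coord] at hy
    exact hy k
  · intro y hy
    rw [b.convexHull_eq_nonneg_coord] at hy
    rw [← b.sum_coord_apply_eq_one y]
    exact Finset.single_le_sum (fun j _ => hy j) (Finset.mem_univ k)
  · intro t ht y
    rw [b.convexHull_eq_nonneg_coord]
    constructor
    · intro h
      refine ⟨fun i => le_trans ?_ (h i), by simpa using h k⟩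
      rw [b.coord_apply]
      split_ifs <;> simp [ht.le]
    · rintro ⟨h, hk⟩ i
      rw [b.coord_apply]
      split_ifs with hik
      · simpa [hik] using hk
      · simpa using h i

theorem setIntegral_inf'_coord (b : AffineBasis ι ℝ E) (μ : Measure E) [μ.IsAddHaarMeasure]
    (hne : (Finset.univ : Finset ι).Nonempty) :
    ∫ y in convexHull ℝ (Set.range b),
        Fintype.card ι * Finset.univ.inf' hne (fun i => b.coord i y) ∂μ =
      (Fintype.card ι : ℝ)⁻¹ * μ.real (convexHull ℝ (Set.range b)) := by
  have : Nonempty ι := b.nonempty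
  have hN : (0 : ℝ) < Fintype.card ι := by positivity
  refine b.setIntegral_eq_of_superlevel μ (c := (Fintype.card ι : ℝ)⁻¹ • ∑ j, b j)
    (continuous_const.mul (Continuous.finset_inf'_apply hne
      fun i _ => continuous_barycentric_coord b i)) ?_ ?_ ?_
  · intro y hy
    rw [b.convexHull_eq_nonneg_coord] at hy
    exact mul_nonneg hN.le (Finset.le_inf' _ _ fun i _ => hy i)
  · intro y _
    rw [← b.sum_coord_apply_eq_one y, ← nsmul_eq_mul, ← Finset.card_univ]
    exact Finset.card_nsmul_le_sum _ _ _ fun i hi => Finset.inf'_le _ hi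
  · intro t ht y
    rw [b.convexHull_eq_nonneg_coord, ← inv_mul_le_iff₀ hN, Finset.le_inf'_iff]
    simp only [b.coord_smul_sum_eq, Finset.mem_univ, true_imp_iff, Set.mem_ofPred_eq,
      mul_comm _ t]
    exact ⟨fun h => ⟨fun i => le_trans (by positivity) (h i), h⟩, And.right⟩

/-- The sharpened right-hand Hermite-Hadamard inequality on a simplex. -/
theorem setIntegral_le_of_convexOn (b : AffineBasis ι ℝ E) (μ : Measure E) [μ.IsAddHaarMeasure]
    {f : E → ℝ} (hf : ConvexOn ℝ (convexHull ℝ (Set.range b)) f) :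
    ∫ y in convexHull ℝ (Set.range b), f y ∂μ ≤
      μ.real (convexHull ℝ (Set.range b)) *
        ((Fintype.card ι : ℝ)⁻¹ * f ((Fintype.card ι : ℝ)⁻¹ • ∑ j, b j) +
          ((Fintype.card ι : ℝ)⁻¹ - (Fintype.card ι : ℝ)⁻¹ ^ 2) * ∑ i, f (b i)) := by
  have : Nonempty ι := b.nonempty
  have hN : (0 : ℝ) < Fintype.card ι := by positivity
  have hne : (Finset.univ : Finset ι).Nonempty := Finset.univ_nonempty
  have hcpt := b.isCompact_convexHull_range_s12
  have hcoord (i : ι) : Continuous (b.coord i) := continuous_barycentric_coord b i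
  set m : E → ℝ := fun y => Fintype.card ι * Finset.univ.inf' hne (fun i => b.coord i y) with hm
  have hmcont : Continuous m :=
    continuous_const.mul (Continuous.finset_inf'_apply hne fun i _ => hcoord i)
  have hint {g : E → ℝ} (hg : Continuous g) :
      Integrable g (μ.restrict (convexHull ℝ (Set.range b))) :=
    hg.continuousOn.integrableOn_compact hcpt
  calc ∫ y in convexHull ℝ (Set.range b), f y ∂μ
      ≤ ∫ y in convexHull ℝ (Set.range b), (m y * f ((Fintype.card ι : ℝ)⁻¹ • ∑ j, b j) +
          ∑ i, (b.coord i y - m y * (Fintype.card ι : ℝ)⁻¹) * f (b i)) ∂μ := by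
        refine setIntegral_mono_on (b.integrableOn_convexHull μ hf) (hint (by fun_prop))
          hcpt.measurableSet fun y hy => ?_
        rw [b.convexHull_eq_nonneg_coord] at hy
        refine b.map_le_of_forall_mul_le_coord hf
          (mul_nonneg hN.le (Finset.le_inf' _ _ fun i _ => hy i)) fun i => ?_
        rw [mul_comm, inv_mul_cancel_left₀ hN.ne']
        exact Finset.inf'_le _ (Finset.mem_univ i)
    _ = _ := by
        rw [integral_add (hint (by fun_prop)) (hint (by fun_prop)),
          integral_finsetSum _ fun i _ => hint (by fun_prop)]
        have hterm (i : ι) : ∫ y in convexHull ℝ (Set.range b),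
            (b.coord i y - m y * (Fintype.card ι : ℝ)⁻¹) * f (b i) ∂μ =
            ((Fintype.card ι : ℝ)⁻¹ - (Fintype.card ι : ℝ)⁻¹ ^ 2) *
              μ.real (convexHull ℝ (Set.range b)) * f (b i) := by
          rw [integral_mul_const, integral_sub (hint (hcoord i)) (hint (by fun_prop)),
            integral_mul_const, b.setIntegral_coord, b.setIntegral_inf'_coord]
          ring
        simp only [hterm, ← Finset.mul_sum]
        rw [integral_mul_const, b.setIntegral_inf'_coord]
        ring

end Integral

end AffineBasis

theorem avg_le_barycenter_vertices (n : ℕ) (x : Fin (n + 1) → EuclideanSpace ℝ (Fin n))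
    (hx : AffineIndependent ℝ x) (f : EuclideanSpace ℝ (Fin n) → ℝ)
    (hf : ConvexOn ℝ (convexHull ℝ (Set.range x)) f) :
    (⨍ y in convexHull ℝ (Set.range x), f y) ≤
      (1 / ((n : ℝ) + 1)) * f (((n : ℝ) + 1)⁻¹ • ∑ i, x i) +
        ((n : ℝ) / ((n : ℝ) + 1)) * ((∑ i, f (x i)) / ((n : ℝ) + 1)) := by
  have htop : affineSpan ℝ (Set.range x) = ⊤ :=
    hx.affineSpan_eq_top_iff_card_eq_finrank_add_one.2 (by simp)
  have hcpt : IsCompact (convexHull ℝ (Set.range x)) :=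
    (Set.finite_range x).isCompact_convexHull ℝ
  have hpos : 0 < volume.real (convexHull ℝ (Set.range x)) :=
    ENNReal.toReal_pos
      (Measure.measure_pos_of_nonempty_interior _
        (interior_convexHull_nonempty_iff_affineSpan_eq_top.2 htop)).ne'
      hcpt.measure_lt_top.ne
  obtain ⟨b, rfl⟩ : ∃ b : AffineBasis (Fin (n + 1)) ℝ (EuclideanSpace ℝ (Fin n)), ⇑b = x :=
    ⟨⟨x, hx, htop⟩, rfl⟩
  have h := b.setIntegral_le_of_convexOn volume hf
  simp only [Fintype.card_fin, Nat.cast_add, Nat.cast_one] at h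
  rw [setAverage_eq, smul_eq_mul, inv_mul_le_iff₀ hpos]
  refine h.trans_eq ?_
  have hn : (n : ℝ) + 1 ≠ 0 := by positivity
  field_simp
  ring
end
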